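/- arXiv:1004.5482 — 7 statements merged into one kernel-verified Lean document; each statement's English description precedes it below -/
import Mathlib

section
/- Define, for a smooth curve u(t) in 𝒞 and a smooth section v(t) along u, the operator D_t v := ∂_t v + (1/2) v ∂_t u + (1/(2Vol)) ∫_M v (∂_t u) e^{u} dμ. Then D_t is the Levi-Civita covariant derivative of the Calabi metric; namely: (i) for every t, ∫_M (D_t v) e^{u(t)} dμ = 0, so D_t v is again a section along u; (ii) for any two smooth sections v, w along u, (d/dt)⟨v,w⟩_{u(t)} = ⟨D_t v, w⟩_{u(t)} + ⟨v, D_t w⟩_{u(t)} (metric compatibility); (iii) for any smooth two-parameter family α(s,t) in 𝒞, D_t(∂_s α) = D_s(∂_t α) (torsion-freeness). -/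
open MeasureTheory Real

/-- The Calabi covariant derivative of a section `v` along a curve `u` in the space of
conformal volume factors: `D_t v = ∂_t v + (1/2) v ∂_t u + (1/(2 Vol)) ∫ v (∂_t u) e^u dμ`. -/
noncomputable def calabiD {M : Type*} [MeasurableSpace M] (μ : Measure M) (Vol : ℝ)
    (u v : ℝ → M → ℝ) (t : ℝ) (p : M) : ℝ :=
  deriv (fun s => v s p) t + (1 / 2) * v t p * deriv (fun s => u s p) t
    + (1 / (2 * Vol)) * ∫ q, v t q * deriv (fun s => u s q) t * Real.exp (u t q) ∂μ

/-- A smooth family of real functions on `M` parametrized by a normed space `E`: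
for each point the dependence on the parameter is `C^∞`, and all parameter-derivatives
are jointly continuous in (parameter, point). -/
def SmoothFamily {E M : Type*} [NormedAddCommGroup E] [NormedSpace ℝ E] [TopologicalSpace M]
    (f : E → M → ℝ) : Prop :=
  (∀ p, ContDiff ℝ (⊤ : ℕ∞) fun z => f z p) ∧
    ∀ n : ℕ, Continuous fun q : E × M => iteratedFDeriv ℝ n (fun z => f z q.2) q.1

/-- Differentiation under the integral sign over a compact space, for an integrand that is
jointly continuous together with its parameter derivative. -/
theorem hasDerivAt_integral_of_continuous_uncurry {M : Type*} [TopologicalSpace M]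
    [CompactSpace M] [MeasurableSpace M] [BorelSpace M] (μ : Measure M) [IsFiniteMeasure μ]
    {F F' : ℝ → M → ℝ} (hF : Continuous (Function.uncurry F))
    (hF' : Continuous (Function.uncurry F'))
    (h : ∀ s p, HasDerivAt (fun r => F r p) (F' s p) s) (t : ℝ) :
    HasDerivAt (fun s => ∫ p, F s p ∂μ) (∫ p, F' t p ∂μ) t := by
  obtain ⟨C, hC⟩ := ((isCompact_closedBall t 1).prod
    (isCompact_univ (X := M))).exists_bound_of_continuousOn hF'.continuousOn
  have slice : ∀ {G : ℝ → M → ℝ}, Continuous (Function.uncurry G) → ∀ s, Continuous (G s) :=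
    fun hG s => hG.comp (Continuous.prodMk_right s)
  refine (hasDerivAt_integral_of_dominated_loc_of_deriv_le (bound := fun _ => C)
    (Metric.closedBall_mem_nhds t one_pos)
    (.of_forall fun s => (slice hF s).measurable.aestronglyMeasurable)
    ((slice hF t).integrable_of_hasCompactSupport (.of_compactSpace _))
    (slice hF' t).measurable.aestronglyMeasurable
    (.of_forall fun p s hs => hC (s, p) ⟨hs, Set.mem_univ p⟩)
    (integrable_const C) (.of_forall fun p s _ => h s p)).2

namespace SmoothFamily

theorem continuous_uncurry {E M : Type*} [NormedAddCommGroup E] [NormedSpace ℝ E]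
    [TopologicalSpace M] {f : E → M → ℝ} (hf : SmoothFamily f) :
    Continuous (Function.uncurry f) :=
  (hf.2 0).eval_const (0 : Fin 0 → E)

theorem hasDerivAt {M : Type*} [TopologicalSpace M] {f : ℝ → M → ℝ} (hf : SmoothFamily f)
    (t : ℝ) (p : M) : HasDerivAt (fun s => f s p) (deriv (fun s => f s p) t) t :=
  ((hf.1 p).differentiable (by simp) t).hasDerivAt

theorem continuous_uncurry_deriv {M : Type*} [TopologicalSpace M] {f : ℝ → M → ℝ}
    (hf : SmoothFamily f) :
    Continuous (Function.uncurry fun t p => deriv (fun s => f s p) t) := by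
  have h := (hf.2 1).eval_const (fun _ : Fin 1 => (1 : ℝ))
  refine h.congr fun q => ?_
  simp [iteratedFDeriv_one_apply, Function.uncurry]

end SmoothFamily

/-- Mixed partial derivatives of a `C²` function of two real variables commute. -/
theorem deriv_deriv_comm_of_contDiff {g : ℝ × ℝ → ℝ} (hg : ContDiff ℝ 2 g) (s t : ℝ) :
    deriv (fun t' => deriv (fun s' => g (s', t')) s) t
      = deriv (fun s' => deriv (fun t' => g (s', t')) t) s := by
  have hd : Differentiable ℝ g := hg.differentiable (by simp)
  have hd' : Differentiable ℝ (fderiv ℝ g) :=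
    (hg.fderiv_right (m := 1) (by norm_num)).differentiable (by simp)
  have left (a b : ℝ) : HasDerivAt (fun x : ℝ => (x, b)) ((1, 0) : ℝ × ℝ) a :=
    (hasDerivAt_id a).prodMk (hasDerivAt_const a b)
  have right (a b : ℝ) : HasDerivAt (fun y : ℝ => (a, y)) ((0, 1) : ℝ × ℝ) b :=
    (hasDerivAt_const b a).prodMk (hasDerivAt_id b)
  have h₁ (a b : ℝ) : deriv (fun x => g (x, b)) a = fderiv ℝ g (a, b) (1, 0) :=
    ((hd (a, b)).hasFDerivAt.comp_hasDerivAt a (left a b)).deriv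
  have h₂ (a b : ℝ) : deriv (fun y => g (a, y)) b = fderiv ℝ g (a, b) (0, 1) :=
    ((hd (a, b)).hasFDerivAt.comp_hasDerivAt b (right a b)).deriv
  simp only [h₁, h₂]
  have apply_eq (v : ℝ × ℝ) {γ : ℝ → ℝ × ℝ} {γ' : ℝ × ℝ} {r : ℝ} (hγ : HasDerivAt γ γ' r) :
      deriv (fun x => fderiv ℝ g (γ x) v) r = fderiv ℝ (fderiv ℝ g) (γ r) γ' v :=
    ((ContinuousLinearMap.apply ℝ ℝ v).hasFDerivAt.comp_hasDerivAt r
      ((hd' (γ r)).hasFDerivAt.comp_hasDerivAt r hγ)).deriv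
  rw [apply_eq _ (right s t), apply_eq _ (left s t)]
  exact (hg.contDiffAt.isSymmSndFDerivAt (by simp)).eq _ _

/-- The operator `D_t` is the Levi-Civita covariant derivative of the
Calabi metric: (i) it maps sections along `u` to sections along `u`; (ii) it is compatible
with the Calabi metric; (iii) it is torsion free. -/
theorem calabi_leviCivita
    {M : Type*} [TopologicalSpace M] [CompactSpace M] [Nonempty M]
    [MeasurableSpace M] [BorelSpace M]
    (μ : Measure M) [IsFiniteMeasure μ] [μ.IsOpenPosMeasure]
    (Vol : ℝ) (hVol : Vol = (μ Set.univ).toReal) (hVolpos : 0 < Vol)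
    -- a smooth curve `u` in 𝒞
    (u : ℝ → M → ℝ) (hu : SmoothFamily u)
    (huC : ∀ t, ∫ p, Real.exp (u t p) ∂μ = Vol)
    -- smooth sections `v`, `w` along `u`
    (v : ℝ → M → ℝ) (hv : SmoothFamily v)
    (hvT : ∀ t, ∫ p, v t p * Real.exp (u t p) ∂μ = 0)
    (w : ℝ → M → ℝ) (hw : SmoothFamily w)
    (hwT : ∀ t, ∫ p, w t p * Real.exp (u t p) ∂μ = 0) :
    -- (i) `D_t v` is again a section along `u`
    (∀ t, ∫ p, calabiD μ Vol u v t p * Real.exp (u t p) ∂μ = 0) ∧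
    -- (ii) metric compatibility
    (∀ t, deriv (fun s => ∫ p, v s p * w s p * Real.exp (u s p) ∂μ) t
        = (∫ p, calabiD μ Vol u v t p * w t p * Real.exp (u t p) ∂μ)
          + ∫ p, v t p * calabiD μ Vol u w t p * Real.exp (u t p) ∂μ) ∧
    -- (iii) torsion freeness on smooth two-parameter families in 𝒞
    (∀ α : ℝ → ℝ → M → ℝ, SmoothFamily (fun z : ℝ × ℝ => α z.1 z.2) →
      (∀ s t, ∫ p, Real.exp (α s t p) ∂μ = Vol) →
      ∀ s t p,
        calabiD μ Vol (fun t' => α s t') (fun t' p' => deriv (fun s' => α s' t' p') s) t p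
          = calabiD μ Vol (fun s' => α s' t) (fun s' p' => deriv (fun t' => α s' t' p') t) s p) := by
  have cu := hu.continuous_uncurry
  have cv := hv.continuous_uncurry
  have cw := hw.continuous_uncurry
  have cu' := hu.continuous_uncurry_deriv
  have cv' := hv.continuous_uncurry_deriv
  have cw' := hw.continuous_uncurry_deriv
  have slice : ∀ {G : ℝ → M → ℝ}, Continuous (Function.uncurry G) → ∀ s, Continuous (G s) :=
    fun hG s => hG.comp (Continuous.prodMk_right s)
  have integrable {f : M → ℝ} (hf : Continuous f) : Integrable f μ :=
    hf.integrable_of_hasCompactSupport (.of_compactSpace _)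
  have hexp (t : ℝ) (p : M) : HasDerivAt (fun s => exp (u s p))
      (exp (u t p) * deriv (fun s => u s p) t) t := (hu.hasDerivAt t p).exp
  refine ⟨fun t => ?_, fun t => ?_, fun α hα _ s t p => ?_⟩
  · have ct := slice cu t
    have cvt := slice cv t
    have ct' := slice cu' t
    have cvt' := slice cv' t
    have hd := hasDerivAt_integral_of_continuous_uncurry μ (F := fun s p => v s p * exp (u s p))
      (F' := fun t p => deriv (fun s => v s p) t * exp (u t p)
        + v t p * (exp (u t p) * deriv (fun s => u s p) t))
      (cv.mul cu.rexp) ((cv'.mul cu.rexp).add (cv.mul (cu.rexp.mul cu')))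
      (fun t p => (hv.hasDerivAt t p).mul (hexp t p)) t
    simp only [hvT] at hd
    have h0 := hd.unique (hasDerivAt_const t 0)
    set c := ∫ q, v t q * deriv (fun s => u s q) t * exp (u t q) ∂μ with hc
    have hsplit : ∀ p, calabiD μ Vol u v t p * exp (u t p)
        = (deriv (fun s => v s p) t * exp (u t p)
            + v t p * (exp (u t p) * deriv (fun s => u s p) t))
          + (-(1 / 2) * (v t p * deriv (fun s => u s p) t * exp (u t p))
            + 1 / (2 * Vol) * c * exp (u t p)) := fun p => by
      rw [calabiD, ← hc]; ring
    simp only [hsplit]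
    rw [integral_add (integrable (by fun_prop)) (integrable (by fun_prop)), h0,
      integral_add (integrable (by fun_prop)) (integrable (by fun_prop)),
      integral_const_mul, integral_const_mul, huC, ← hc]
    field_simp
    ring
  · have ct := slice cu t
    have cvt := slice cv t
    have cwt := slice cw t
    have ct' := slice cu' t
    have cvt' := slice cv' t
    have cwt' := slice cw' t
    have hd := hasDerivAt_integral_of_continuous_uncurry μ
      (F := fun s p => v s p * w s p * exp (u s p))
      (F' := fun t p => (deriv (fun s => v s p) t * w t p + v t p * deriv (fun s => w s p) t)
          * exp (u t p) + v t p * w t p * (exp (u t p) * deriv (fun s => u s p) t))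
      ((cv.mul cw).mul cu.rexp)
      ((((cv'.mul cw).add (cv.mul cw')).mul cu.rexp).add ((cv.mul cw).mul (cu.rexp.mul cu')))
      (fun t p => ((hv.hasDerivAt t p).mul (hw.hasDerivAt t p)).mul (hexp t p)) t
    have continuous_calabiD {x : ℝ → M → ℝ} (hx : Continuous (x t))
        (hx' : Continuous fun p => deriv (fun s => x s p) t) :
        Continuous (calabiD μ Vol u x t) := by
      unfold calabiD; fun_prop
    have cDv := continuous_calabiD cvt cvt'
    have cDw := continuous_calabiD cwt cwt'
    rw [hd.deriv, ← integral_add (μ := μ)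
      (f := fun p => calabiD μ Vol u v t p * w t p * exp (u t p))
      (integrable (by fun_prop)) (integrable (by fun_prop))]
    set cᵥ := ∫ q, v t q * deriv (fun s => u s q) t * exp (u t q) ∂μ with hcᵥ
    set c := ∫ q, w t q * deriv (fun s => u s q) t * exp (u t q) ∂μ with hc
    have hsplit : ∀ p, calabiD μ Vol u v t p * w t p * exp (u t p)
          + v t p * calabiD μ Vol u w t p * exp (u t p)
        = ((deriv (fun s => v s p) t * w t p + v t p * deriv (fun s => w s p) t)
            * exp (u t p) + v t p * w t p * (exp (u t p) * deriv (fun s => u s p) t))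
          + (1 / (2 * Vol) * cᵥ * (w t p * exp (u t p))
            + 1 / (2 * Vol) * c * (v t p * exp (u t p))) := fun p => by
      rw [calabiD, calabiD, ← hc, ← hcᵥ]; ring
    have herr : ∫ p, (1 / (2 * Vol) * cᵥ * (w t p * exp (u t p))
        + 1 / (2 * Vol) * c * (v t p * exp (u t p))) ∂μ = 0 := by
      rw [integral_add (integrable (by fun_prop)) (integrable (by fun_prop)),
        integral_const_mul, integral_const_mul, hvT, hwT]
      ring
    simp only [hsplit]
    rw [integral_add (f := fun p => _ + _) (integrable (by fun_prop)) (integrable (by fun_prop)),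
      herr, add_zero]
  · have hmixed := deriv_deriv_comm_of_contDiff ((hα.1 p).of_le (WithTop.coe_le_coe.2 le_top)) s t
    simp only [calabiD]
    rw [hmixed, mul_assoc, mul_assoc,
      mul_comm (deriv (fun s' => α s' t p) s) (deriv (fun t' => α s t' p) t)]
    simp only [mul_comm (deriv (fun s' => α s' t _) s)]
end

section
/- Let u = u(q,r,s,t) be a smooth four-parameter family in 𝒞. Then the curvature operator of the Calabi covariant derivative satisfies pointwise (D_q D_r − D_r D_q)(∂_s u) = (1/(4Vol)) ( ⟨∂_r u, ∂_s u⟩_u · ∂_q u − ⟨∂_q u, ∂_s u⟩_u · ∂_r u ), and consequently the curvature tensor R(∂_q u, ∂_r u, ∂_s u, ∂_t u) := ⟨(D_q D_r − D_r D_q)(∂_s u), ∂_t u⟩_u equals (1/(4Vol)) ( ⟨∂_r u, ∂_s u⟩_u ⟨∂_q u, ∂_t u⟩_u − ⟨∂_q u, ∂_s u⟩_u ⟨∂_r u, ∂_t u⟩_u ). -/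
open MeasureTheory Real

/-- The curvature operator `(D_q D_r - D_r D_q)(∂_s u)` of the Calabi covariant
derivative on a four-parameter family `u`. -/
noncomputable def calabiCurvOp {M : Type*} [MeasurableSpace M] (μ : Measure M) (Vol : ℝ)
    (u : ℝ → ℝ → ℝ → ℝ → M → ℝ) (q r s t : ℝ) (p : M) : ℝ :=
  calabiD μ Vol (fun q' => u q' r s t)
      (fun q' p' => calabiD μ Vol (fun r' => u q' r' s t)
        (fun r' p'' => deriv (fun s' => u q' r' s' t p'') s) r p') q p
    - calabiD μ Vol (fun r' => u q r' s t)
      (fun r' p' => calabiD μ Vol (fun q' => u q' r' s t)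
        (fun q' p'' => deriv (fun s' => u q' r' s' t p'') s) q p') r p

/-- The Calabi inner product at the point `u` of 𝒞. -/
noncomputable def calabiInner {M : Type*} [MeasurableSpace M] (μ : Measure M)
    (u a b : M → ℝ) : ℝ :=
  ∫ p, a p * b p * Real.exp (u p) ∂μ

theorem integrable_of_continuous_of_compactSpace {M : Type*} [TopologicalSpace M] [CompactSpace M]
    [MeasurableSpace M] [BorelSpace M] (μ : Measure M) [IsFiniteMeasure μ]
    {g : M → ℝ} (hg : Continuous g) : Integrable g μ :=
  hg.integrable_of_hasCompactSupport (HasCompactSupport.of_compactSpace g)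

/-- Differentiation under the integral sign over a compact space. -/
theorem hasDerivAt_integral_of_continuous_of_compactSpace {M : Type*} [TopologicalSpace M]
    [CompactSpace M] [MeasurableSpace M] [BorelSpace M] (μ : Measure M) [IsFiniteMeasure μ]
    {F F' : ℝ → M → ℝ} (hF : Continuous fun z : ℝ × M => F z.1 z.2)
    (hF' : Continuous fun z : ℝ × M => F' z.1 z.2)
    (hd : ∀ x p, HasDerivAt (fun y => F y p) (F' x p) x) (x : ℝ) :
    HasDerivAt (fun y => ∫ p, F y p ∂μ) (∫ p, F' x p ∂μ) x := by
  have hK : IsCompact (Metric.closedBall x 1 ×ˢ (Set.univ : Set M)) :=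
    (isCompact_closedBall x 1).prod isCompact_univ
  obtain ⟨C, hC⟩ := hK.exists_bound_of_continuousOn hF'.continuousOn
  have hFx (y : ℝ) : Continuous (F y) := hF.comp (Continuous.prodMk_right y)
  have hF'x : Continuous (F' x) := hF'.comp (Continuous.prodMk_right x)
  refine (hasDerivAt_integral_of_dominated_loc_of_deriv_le (bound := fun _ => C)
    (Metric.closedBall_mem_nhds x one_pos)
    (Filter.Eventually.of_forall fun y =>
      (integrable_of_continuous_of_compactSpace μ (hFx y)).aestronglyMeasurable)
    (integrable_of_continuous_of_compactSpace μ (hFx x))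
    (integrable_of_continuous_of_compactSpace μ hF'x).aestronglyMeasurable
    (Filter.Eventually.of_forall fun p y hy => hC (y, p) ⟨hy, Set.mem_univ _⟩)
    (integrable_const C) (Filter.Eventually.of_forall fun p y _ => hd y p)).2

/-- The Calabi derivative of a section which is itself given by the formula for a Calabi
derivative, along a curve `f` of constant volume. -/
theorem calabiD_of_hasDerivAt {M : Type*} [TopologicalSpace M] [CompactSpace M]
    [MeasurableSpace M] [BorelSpace M] (μ : Measure M) [IsFiniteMeasure μ] (Vol : ℝ)
    {f f' g g' w w' v v' : ℝ → M → ℝ}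
    (hf : Continuous fun z : ℝ × M => f z.1 z.2) (hf' : Continuous fun z : ℝ × M => f' z.1 z.2)
    (hg : Continuous fun z : ℝ × M => g z.1 z.2) (hg' : Continuous fun z : ℝ × M => g' z.1 z.2)
    (hw : Continuous fun z : ℝ × M => w z.1 z.2) (hw' : Continuous fun z : ℝ × M => w' z.1 z.2)
    (hv : Continuous fun z : ℝ × M => v z.1 z.2)
    (df : ∀ x p, HasDerivAt (fun y => f y p) (f' x p) x)
    (dg : ∀ x p, HasDerivAt (fun y => g y p) (g' x p) x)
    (dw : ∀ x p, HasDerivAt (fun y => w y p) (w' x p) x)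
    (dv : ∀ x p, HasDerivAt (fun y => v y p) (v' x p) x)
    (hVol : ∀ x, ∫ p, exp (f x p) ∂μ = Vol) (x : ℝ) (p : M) :
    calabiD μ Vol f
        (fun y p => v y p + (1 / 2) * w y p * g y p
          + (1 / (2 * Vol)) * ∫ m, w y m * g y m * exp (f y m) ∂μ) x p
      = v' x p + (1 / 2) * (w' x p * g x p + v x p * f' x p + w x p * g' x p)
        + (1 / 4) * (w x p * g x p * f' x p)
        + (1 / (4 * Vol)) * (∫ m, w x m * g x m * exp (f x m) ∂μ) * f' x p
        + (1 / (2 * Vol)) * ∫ m, (w' x m * g x m + v x m * f' x m + w x m * g' x m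
            + (3 / 2) * (w x m * g x m * f' x m)) * exp (f x m) ∂μ := by
  have int0 : ∫ m, exp (f x m) * f' x m ∂μ = 0 := by
    have h := hasDerivAt_integral_of_continuous_of_compactSpace μ
      (F := fun y m => exp (f y m)) (F' := fun y m => exp (f y m) * f' y m)
      (by fun_prop) (by fun_prop) (fun y m => (df y m).exp) x
    simp only [hVol] at h
    exact h.unique (hasDerivAt_const x Vol)
  have dint := hasDerivAt_integral_of_continuous_of_compactSpace μ
      (F := fun y m => w y m * g y m * exp (f y m))
      (F' := fun y m => (w' y m * g y m + w y m * g' y m) * exp (f y m)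
        + w y m * g y m * (exp (f y m) * f' y m))
      (by fun_prop) (by fun_prop) (fun y m => ((dw y m).mul (dg y m)).mul (df y m).exp) x
  have dsec := (((dv x p).add (((dw x p).const_mul (1 / 2)).mul (dg x p))).add
    (dint.const_mul (1 / (2 * Vol)))).deriv
  have slice {h : ℝ → M → ℝ} (hh : Continuous fun z : ℝ × M => h z.1 z.2) :
      Continuous (h x) := hh.comp (Continuous.prodMk_right x)
  have cf := slice hf
  have cf' := slice hf'
  have cg := slice hg
  have cg' := slice hg'
  have cw := slice hw
  have cw' := slice hw'
  have cv := slice hv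
  unfold calabiD
  simp only [Pi.add_def, Pi.mul_def] at dsec
  rw [dsec, (df x p).deriv]
  simp only [(df x _).deriv]
  set I := ∫ m, w x m * g x m * exp (f x m) ∂μ
  have split : ∫ m, (v x m + (1 / 2) * w x m * g x m + (1 / (2 * Vol)) * I) * f' x m
        * exp (f x m) ∂μ
      = ∫ m, (v x m + (1 / 2) * w x m * g x m) * f' x m * exp (f x m) ∂μ := by
    calc _ = ∫ m, ((v x m + (1 / 2) * w x m * g x m) * f' x m * exp (f x m)
          + (1 / (2 * Vol)) * I * (exp (f x m) * f' x m)) ∂μ := by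
            congr 1; ext m; ring
      _ = _ := by
        rw [integral_add (integrable_of_continuous_of_compactSpace μ (by fun_prop))
          (integrable_of_continuous_of_compactSpace μ (by fun_prop)), integral_const_mul, int0]
        ring
  have join : ∫ m, (w' x m * g x m + v x m * f' x m + w x m * g' x m
            + (3 / 2) * (w x m * g x m * f' x m)) * exp (f x m) ∂μ
      = (∫ m, ((w' x m * g x m + w x m * g' x m) * exp (f x m)
          + w x m * g x m * (exp (f x m) * f' x m)) ∂μ)
        + ∫ m, (v x m + (1 / 2) * w x m * g x m) * f' x m * exp (f x m) ∂μ := by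
    rw [← integral_add (integrable_of_continuous_of_compactSpace μ (by fun_prop))
          (integrable_of_continuous_of_compactSpace μ (by fun_prop))]
    congr 1; ext m; ring
  rw [split, join]
  ring

/-- The directional derivative of a family of functions along the vector `a`. -/
noncomputable def dirDeriv {E M : Type*} [NormedAddCommGroup E] [NormedSpace ℝ E] (a : E)
    (f : E → M → ℝ) (z : E) (p : M) : ℝ :=
  fderiv ℝ (fun y => f y p) z a

section DirDeriv

variable {E M : Type*} [NormedAddCommGroup E] [NormedSpace ℝ E] {f : E → M → ℝ}

theorem contDiff_dirDeriv (hf : ∀ p, ContDiff ℝ (⊤ : ℕ∞) fun z => f z p) (a : E) (p : M) :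
    ContDiff ℝ (⊤ : ℕ∞) fun z => dirDeriv a f z p :=
  ((hf p).fderiv_right (m := (⊤ : ℕ∞)) (by simp)).clm_apply contDiff_const

theorem dirDeriv_dirDeriv_apply (hf : ∀ p, ContDiff ℝ (⊤ : ℕ∞) fun z => f z p) (a b : E) (z : E)
    (p : M) : dirDeriv a (dirDeriv b f) z p = fderiv ℝ (fderiv ℝ fun y => f y p) z a b := by
  have h : DifferentiableAt ℝ (fderiv ℝ fun y => f y p) z :=
    ((hf p).fderiv_right (m := (⊤ : ℕ∞)) (by simp)).differentiable (by simp) z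
  simp only [dirDeriv]
  rw [fderiv_clm_apply h (differentiableAt_const b)]
  simp

theorem dirDeriv_comm (hf : ∀ p, ContDiff ℝ (⊤ : ℕ∞) fun z => f z p) (a b : E) :
    dirDeriv a (dirDeriv b f) = dirDeriv b (dirDeriv a f) := by
  ext z p
  rw [dirDeriv_dirDeriv_apply hf, dirDeriv_dirDeriv_apply hf]
  exact (hf p).contDiffAt.isSymmSndFDerivAt (by
    rw [minSmoothness_of_isRCLikeNormedField]
    exact WithTop.coe_le_coe.2 (le_top : (2 : ℕ∞) ≤ ⊤)) a b

theorem hasDerivAt_dirDeriv (hf : ∀ p, ContDiff ℝ (⊤ : ℕ∞) fun z => f z p) {c : ℝ → E} {a : E}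
    {x : ℝ} (hc : HasDerivAt c a x) (p : M) :
    HasDerivAt (fun y => f (c y) p) (dirDeriv a f (c x) p) x :=
  ((hf p).differentiable (by simp) (c x)).hasFDerivAt.comp_hasDerivAt x hc

variable [TopologicalSpace M]

theorem SmoothFamily.continuous (hf : SmoothFamily f) :
    Continuous fun z : E × M => f z.1 z.2 := by
  have h := (ContinuousMultilinearMap.apply ℝ (fun _ : Fin 0 => E) ℝ ![]).continuous.comp (hf.2 0)
  simpa [Function.comp_def] using h

theorem SmoothFamily.continuous_dirDeriv (hf : SmoothFamily f) (a : E) :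
    Continuous fun z : E × M => dirDeriv a f z.1 z.2 := by
  have h := (ContinuousMultilinearMap.apply ℝ (fun _ : Fin 1 => E) ℝ ![a]).continuous.comp (hf.2 1)
  simpa [Function.comp_def, dirDeriv] using h

theorem SmoothFamily.continuous_dirDeriv_dirDeriv (hf : SmoothFamily f) (a b : E) :
    Continuous fun z : E × M => dirDeriv a (dirDeriv b f) z.1 z.2 := by
  have h := (ContinuousMultilinearMap.apply ℝ (fun _ : Fin 2 => E) ℝ ![a, b]).continuous.comp
    (hf.2 2)
  simpa [Function.comp_def, iteratedFDeriv_two_apply, dirDeriv_dirDeriv_apply hf.1] using h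

end DirDeriv

/-- For a smooth four-parameter family `u` in 𝒞, the curvature operator is
`(D_q D_r − D_r D_q)(∂_s u) = (1/(4 Vol)) (⟨u_r,u_s⟩ u_q − ⟨u_q,u_s⟩ u_r)`, and the curvature
tensor is `R(u_q,u_r,u_s,u_t) = (1/(4 Vol)) (⟨u_r,u_s⟩⟨u_q,u_t⟩ − ⟨u_q,u_s⟩⟨u_r,u_t⟩)`. -/
theorem calabi_curvature_tensor
    {M : Type*} [TopologicalSpace M] [CompactSpace M] [Nonempty M]
    [MeasurableSpace M] [BorelSpace M]
    (μ : Measure M) [IsFiniteMeasure μ] [μ.IsOpenPosMeasure]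
    (Vol : ℝ) (hVol : Vol = (μ Set.univ).toReal) (hVolpos : 0 < Vol)
    (u : ℝ → ℝ → ℝ → ℝ → M → ℝ)
    (hu : SmoothFamily (fun z : ℝ × ℝ × ℝ × ℝ => u z.1 z.2.1 z.2.2.1 z.2.2.2))
    (huC : ∀ q r s t, ∫ p, Real.exp (u q r s t p) ∂μ = Vol) :
    ∀ q r s t : ℝ,
      -- pointwise identity for the curvature operator
      (∀ p, calabiCurvOp μ Vol u q r s t p
          = (1 / (4 * Vol)) *
              (calabiInner μ (u q r s t) (fun p' => deriv (fun r' => u q r' s t p') r)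
                  (fun p' => deriv (fun s' => u q r s' t p') s)
                  * deriv (fun q' => u q' r s t p) q
                - calabiInner μ (u q r s t) (fun p' => deriv (fun q' => u q' r s t p') q)
                    (fun p' => deriv (fun s' => u q r s' t p') s)
                  * deriv (fun r' => u q r' s t p) r))
      ∧
      -- the curvature tensor
      calabiInner μ (u q r s t) (fun p => calabiCurvOp μ Vol u q r s t p)
          (fun p => deriv (fun t' => u q r s t' p) t)
        = (1 / (4 * Vol)) *
            (calabiInner μ (u q r s t) (fun p => deriv (fun r' => u q r' s t p) r)
                (fun p => deriv (fun s' => u q r s' t p) s)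
              * calabiInner μ (u q r s t) (fun p => deriv (fun q' => u q' r s t p) q)
                (fun p => deriv (fun t' => u q r s t' p) t)
              - calabiInner μ (u q r s t) (fun p => deriv (fun q' => u q' r s t p) q)
                  (fun p => deriv (fun s' => u q r s' t p) s)
                * calabiInner μ (u q r s t) (fun p => deriv (fun r' => u q r' s t p) r)
                  (fun p => deriv (fun t' => u q r s t' p) t)) := by
  intro q r s t
  set U : ℝ × ℝ × ℝ × ℝ → M → ℝ := fun z => u z.1 z.2.1 z.2.2.1 z.2.2.2
  let e₁ : ℝ × ℝ × ℝ × ℝ := (1, 0, 0, 0)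
  let e₂ : ℝ × ℝ × ℝ × ℝ := (0, 1, 0, 0)
  let e₃ : ℝ × ℝ × ℝ × ℝ := (0, 0, 1, 0)
  let e₄ : ℝ × ℝ × ℝ × ℝ := (0, 0, 0, 1)
  have c₁ (q r : ℝ) : HasDerivAt (fun x => (x, r, s, t)) e₁ q :=
    (hasDerivAt_id q).prodMk (hasDerivAt_const q (r, s, t))
  have c₂ (q r : ℝ) : HasDerivAt (fun x => (q, x, s, t)) e₂ r :=
    (hasDerivAt_const r q).prodMk ((hasDerivAt_id r).prodMk (hasDerivAt_const r (s, t)))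
  have c₃ (q r : ℝ) : HasDerivAt (fun x => (q, r, x, t)) e₃ s :=
    (hasDerivAt_const s q).prodMk ((hasDerivAt_const s r).prodMk
      ((hasDerivAt_id s).prodMk (hasDerivAt_const s t)))
  have c₄ : HasDerivAt (fun x => (q, r, s, x)) e₄ t :=
    (hasDerivAt_const t q).prodMk ((hasDerivAt_const t r).prodMk
      ((hasDerivAt_const t s).prodMk (hasDerivAt_id t)))
  have du₁ (q r : ℝ) (p : M) :
      deriv (fun x => u x r s t p) q = dirDeriv e₁ U (q, r, s, t) p :=
    (hasDerivAt_dirDeriv hu.1 (c₁ q r) p).deriv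
  have du₂ (q r : ℝ) (p : M) :
      deriv (fun x => u q x s t p) r = dirDeriv e₂ U (q, r, s, t) p :=
    (hasDerivAt_dirDeriv hu.1 (c₂ q r) p).deriv
  have du₃ (q r : ℝ) (p : M) :
      deriv (fun x => u q r x t p) s = dirDeriv e₃ U (q, r, s, t) p :=
    (hasDerivAt_dirDeriv hu.1 (c₃ q r) p).deriv
  have du₄ (p : M) : deriv (fun x => u q r s x p) t = dirDeriv e₄ U (q, r, s, t) p :=
    (hasDerivAt_dirDeriv hu.1 c₄ p).deriv
  have hdu (a : ℝ × ℝ × ℝ × ℝ) := contDiff_dirDeriv hu.1 a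
  have hddu (a b : ℝ × ℝ × ℝ × ℝ) := contDiff_dirDeriv (hdu b) a
  have cu := hu.continuous
  have cdu (a : ℝ × ℝ × ℝ × ℝ) := hu.continuous_dirDeriv a
  have cddu (a b : ℝ × ℝ × ℝ × ℝ) := hu.continuous_dirDeriv_dirDeriv a b
  have curv (p : M) : calabiCurvOp μ Vol u q r s t p
      = (1 / (4 * Vol)) *
          (calabiInner μ (u q r s t) (dirDeriv e₂ U (q, r, s, t)) (dirDeriv e₃ U (q, r, s, t))
              * dirDeriv e₁ U (q, r, s, t) p
            - calabiInner μ (u q r s t) (dirDeriv e₁ U (q, r, s, t)) (dirDeriv e₃ U (q, r, s, t))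
              * dirDeriv e₂ U (q, r, s, t) p) := by
    have k₁ : Continuous fun z : ℝ × M => ((z.1, r, s, t), z.2) := by fun_prop
    have k₂ : Continuous fun z : ℝ × M => ((q, z.1, s, t), z.2) := by fun_prop
    have hqr := calabiD_of_hasDerivAt μ Vol (cu.comp k₁) ((cdu e₁).comp k₁) ((cdu e₂).comp k₁)
      ((cddu e₁ e₂).comp k₁) ((cdu e₃).comp k₁) ((cddu e₁ e₃).comp k₁) ((cddu e₂ e₃).comp k₁)
      (fun x p => hasDerivAt_dirDeriv hu.1 (c₁ x r) p)
      (fun x p => hasDerivAt_dirDeriv (hdu e₂) (c₁ x r) p)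
      (fun x p => hasDerivAt_dirDeriv (hdu e₃) (c₁ x r) p)
      (fun x p => hasDerivAt_dirDeriv (hddu e₂ e₃) (c₁ x r) p)
      (fun x => huC x r s t) q p
    have hrq := calabiD_of_hasDerivAt μ Vol (cu.comp k₂) ((cdu e₂).comp k₂) ((cdu e₁).comp k₂)
      ((cddu e₂ e₁).comp k₂) ((cdu e₃).comp k₂) ((cddu e₂ e₃).comp k₂) ((cddu e₁ e₃).comp k₂)
      (fun x p => hasDerivAt_dirDeriv hu.1 (c₂ q x) p)
      (fun x p => hasDerivAt_dirDeriv (hdu e₁) (c₂ q x) p)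
      (fun x p => hasDerivAt_dirDeriv (hdu e₃) (c₂ q x) p)
      (fun x p => hasDerivAt_dirDeriv (hddu e₁ e₃) (c₂ q x) p)
      (fun x => huC q x s t) r p
    have inner₁ (x : ℝ) (m : M) : calabiD μ Vol (fun r' => u x r' s t)
        (fun r' m' => dirDeriv e₃ U (x, r', s, t) m') r m
        = dirDeriv e₂ (dirDeriv e₃ U) (x, r, s, t) m
          + (1 / 2) * dirDeriv e₃ U (x, r, s, t) m * dirDeriv e₂ U (x, r, s, t) m
          + (1 / (2 * Vol)) * ∫ y, dirDeriv e₃ U (x, r, s, t) y * dirDeriv e₂ U (x, r, s, t) y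
            * exp (u x r s t y) ∂μ := by
      simp only [calabiD, du₂, (hasDerivAt_dirDeriv (hdu e₃) (c₂ x r) m).deriv]
    have inner₂ (x : ℝ) (m : M) : calabiD μ Vol (fun q' => u q' x s t)
        (fun q' m' => dirDeriv e₃ U (q', x, s, t) m') q m
        = dirDeriv e₁ (dirDeriv e₃ U) (q, x, s, t) m
          + (1 / 2) * dirDeriv e₃ U (q, x, s, t) m * dirDeriv e₁ U (q, x, s, t) m
          + (1 / (2 * Vol)) * ∫ y, dirDeriv e₃ U (q, x, s, t) y * dirDeriv e₁ U (q, x, s, t) y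
            * exp (u q x s t y) ∂μ := by
      simp only [calabiD, du₁, (hasDerivAt_dirDeriv (hdu e₃) (c₁ q x) m).deriv]
    simp only [calabiCurvOp, du₃, inner₁, inner₂]
    refine (congrArg₂ (· - ·) hqr hrq).trans ?_
    simp only [calabiInner, dirDeriv_comm hu.1 e₂ e₁, dirDeriv_comm (hdu e₃) e₂ e₁]
    change _ = (1 / (4 * Vol)) *
      ((∫ m, dirDeriv e₂ U (q, r, s, t) m * dirDeriv e₃ U (q, r, s, t) m
          * exp (U (q, r, s, t) m) ∂μ) * dirDeriv e₁ U (q, r, s, t) p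
        - (∫ m, dirDeriv e₁ U (q, r, s, t) m * dirDeriv e₃ U (q, r, s, t) m
          * exp (U (q, r, s, t) m) ∂μ) * dirDeriv e₂ U (q, r, s, t) p)
    have comm (a b : ℝ × ℝ × ℝ × ℝ) :
        ∫ m, dirDeriv a U (q, r, s, t) m * dirDeriv b U (q, r, s, t) m
          * exp (U (q, r, s, t) m) ∂μ
        = ∫ m, dirDeriv b U (q, r, s, t) m * dirDeriv a U (q, r, s, t) m
          * exp (U (q, r, s, t) m) ∂μ := by
      congr 1; ext m; ring
    rw [comm e₃ e₂, comm e₃ e₁, add_sub_add_comm]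
    refine (congrArg₂ (· + ·) rfl (sub_eq_zero.2 (congrArg (1 / (2 * Vol) * ·)
      (integral_congr_ae (Filter.Eventually.of_forall fun m => ?_))))).trans ?_ <;> ring
  have slice {h : ℝ × ℝ × ℝ × ℝ → M → ℝ}
      (hh : Continuous fun z : (ℝ × ℝ × ℝ × ℝ) × M => h z.1 z.2) :
      Continuous (h (q, r, s, t)) := hh.comp (Continuous.prodMk_right (q, r, s, t))
  have d₁ := slice (cdu e₁)
  have d₂ := slice (cdu e₂)
  have d₄ := slice (cdu e₄)
  have d₀ : Continuous (u q r s t) := slice cu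
  simp only [du₁, du₂, du₃, du₄, curv]
  refine ⟨fun _ => trivial, ?_⟩
  generalize calabiInner μ (u q r s t) (dirDeriv e₂ U (q, r, s, t))
    (dirDeriv e₃ U (q, r, s, t)) = A
  generalize calabiInner μ (u q r s t) (dirDeriv e₁ U (q, r, s, t))
    (dirDeriv e₃ U (q, r, s, t)) = B
  simp only [calabiInner]
  rw [← integral_const_mul, ← integral_const_mul, ← integral_sub
    (integrable_of_continuous_of_compactSpace μ (by fun_prop))
    (integrable_of_continuous_of_compactSpace μ (by fun_prop)), ← integral_const_mul]
  congr 1; ext m; ring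
end

section
/- Let u = u(s,t) be a smooth two-parameter family in 𝒞 such that at a given parameter point the functions ∂_s u and ∂_t u are linearly independent over ℝ. Then the denominator ⟨∂_s u,∂_s u⟩_u ⟨∂_t u,∂_t u⟩_u − ⟨∂_s u,∂_t u⟩_u² is strictly positive and the sectional curvature K := − ⟨(D_s D_t − D_t D_s)(∂_s u), ∂_t u⟩_u / ( ⟨∂_s u,∂_s u⟩_u ⟨∂_t u,∂_t u⟩_u − ⟨∂_s u,∂_t u⟩_u² ) equals 1/(4Vol). In particular the sectional curvature of the Calabi metric is positive, constant, and depends only on the volume of M. -/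
open MeasureTheory Real

/-- `D_t (∂_s u)` for a two-parameter family `u`. -/
noncomputable def DtUs {M : Type*} [MeasurableSpace M] (μ : Measure M) (Vol : ℝ)
    (u : ℝ → ℝ → M → ℝ) (s t : ℝ) (p : M) : ℝ :=
  calabiD μ Vol (fun t' => u s t') (fun t' p' => deriv (fun s' => u s' t' p') s) t p

/-- `D_s (∂_s u)` for a two-parameter family `u`. -/
noncomputable def DsUs {M : Type*} [MeasurableSpace M] (μ : Measure M) (Vol : ℝ)
    (u : ℝ → ℝ → M → ℝ) (s t : ℝ) (p : M) : ℝ :=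
  calabiD μ Vol (fun s' => u s' t) (fun s' p' => deriv (fun s'' => u s'' t p') s') s p

/-- `(D_s D_t − D_t D_s)(∂_s u)` for a two-parameter family `u`. -/
noncomputable def sectCurvOp {M : Type*} [MeasurableSpace M] (μ : Measure M) (Vol : ℝ)
    (u : ℝ → ℝ → M → ℝ) (s t : ℝ) (p : M) : ℝ :=
  calabiD μ Vol (fun s' => u s' t) (fun s' p' => DtUs μ Vol u s' t p') s p
    - calabiD μ Vol (fun t' => u s t') (fun t' p' => DsUs μ Vol u s t' p') t p

/-- The derivative of a family of functions in the parameter direction `w`. -/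
noncomputable def paramDeriv {E M : Type*} [NormedAddCommGroup E] [NormedSpace ℝ E]
    (w : E) (f : E → M → ℝ) (z : E) (p : M) : ℝ :=
  fderiv ℝ (fun z => f z p) z w

namespace SmoothFamily

variable {E M : Type*} [NormedAddCommGroup E] [NormedSpace ℝ E] [TopologicalSpace M]
  {f : E → M → ℝ}

theorem continuous_uncurry_s2 (hf : SmoothFamily f) : Continuous fun q : E × M => f q.1 q.2 := by
  have h := (ContinuousMultilinearMap.apply ℝ (fun _ : Fin 0 => E) ℝ 0).continuous.comp (hf.2 0)
  exact h

theorem paramDeriv (hf : SmoothFamily f) (w : E) : SmoothFamily (paramDeriv w f) := by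
  have hd : ∀ p, ContDiff ℝ (⊤ : ℕ∞) (fderiv ℝ fun z => f z p) := fun p =>
    (hf.1 p).fderiv_right (by simp)
  refine ⟨fun p => (hd p).clm_apply contDiff_const, fun n => ?_⟩
  have iteratedFDeriv_eq : ∀ q : E × M,
      iteratedFDeriv ℝ n (fun z => _root_.paramDeriv w f z q.2) q.1 =
        (ContinuousLinearMap.apply ℝ ℝ w).compContinuousMultilinearMap
          ((continuousMultilinearCurryRightEquiv' ℝ n E ℝ)
            (iteratedFDeriv ℝ (n + 1) (fun z => f z q.2) q.1)) := by
    intro q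
    have h1 := (ContinuousLinearMap.apply ℝ ℝ w).iteratedFDeriv_comp_left
      (hd q.2).contDiffAt (x := q.1) (i := n) (by exact_mod_cast le_top)
    have h2 : (continuousMultilinearCurryRightEquiv' ℝ n E ℝ)
        (iteratedFDeriv ℝ (n + 1) (fun z => f z q.2) q.1)
          = iteratedFDeriv ℝ n (fderiv ℝ fun z => f z q.2) q.1 := by
      rw [iteratedFDeriv_succ_eq_comp_right]
      simp
    rw [h2, ← h1]
    rfl
  simp only [iteratedFDeriv_eq]
  exact (ContinuousLinearMap.compContinuousMultilinearMapL ℝ (fun _ : Fin n => E) _ ℝ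
    (ContinuousLinearMap.apply ℝ ℝ w)).continuous.comp
      ((continuousMultilinearCurryRightEquiv' ℝ n E ℝ).continuous.comp (hf.2 (n + 1)))

theorem paramDeriv_comm (hf : SmoothFamily f) (v w : E) (z : E) (p : M) :
    _root_.paramDeriv v (_root_.paramDeriv w f) z p
      = _root_.paramDeriv w (_root_.paramDeriv v f) z p := by
  have hd : DifferentiableAt ℝ (fderiv ℝ fun z => f z p) z :=
    (((hf.1 p).fderiv_right (m := (⊤ : ℕ∞)) (by simp)).differentiable (by simp)) z
  have h : ∀ v w : E, _root_.paramDeriv v (_root_.paramDeriv w f) z p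
      = fderiv ℝ (fderiv ℝ fun z => f z p) z v w := by
    intro v w
    have := (hd.hasFDerivAt.clm_apply (hasFDerivAt_const w z)).fderiv
    change fderiv ℝ (fun y => fderiv ℝ (fun z => f z p) y w) z v = _
    rw [this]
    simp
  rw [h, h]
  exact ((hf.1 p).contDiffAt.isSymmSndFDerivAt (by
    rw [minSmoothness_of_isRCLikeNormedField]
    exact WithTop.coe_le_coe.2 (le_top (a := (2 : ℕ∞))))) v w

theorem hasDerivAt_comp (hf : SmoothFamily f) {γ : ℝ → E} {w : E} {x : ℝ}
    (hγ : HasDerivAt γ w x) (p : M) :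
    HasDerivAt (fun y => f (γ y) p) (_root_.paramDeriv w f (γ x) p) x :=
  (((hf.1 p).differentiable (by simp)) (γ x)).hasFDerivAt.comp_hasDerivAt x hγ

end SmoothFamily

theorem calabiInner_comm {M : Type*} [MeasurableSpace M] (μ : Measure M) (u a b : M → ℝ) :
    calabiInner μ u a b = calabiInner μ u b a := by
  simp only [calabiInner, mul_comm (a _)]

section CompactIntegral

variable {M : Type*} [TopologicalSpace M] [CompactSpace M] [MeasurableSpace M] [BorelSpace M]
  (μ : Measure M) [IsFiniteMeasure μ]

theorem integrable_of_continuous_of_compactSpace_s2 {f : M → ℝ} (hf : Continuous f) :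
    Integrable f μ := by
  obtain ⟨C, hC⟩ := isCompact_univ.exists_bound_of_continuousOn hf.continuousOn
  exact Integrable.of_bound hf.measurable.aestronglyMeasurable C
    (Filter.Eventually.of_forall fun p => hC p trivial)

/-- Differentiation under the integral sign over a compact space. -/
theorem hasDerivAt_integral_of_continuous_uncurry_s2 {g g' : ℝ → M → ℝ}
    (hg : Continuous fun q : ℝ × M => g q.1 q.2) (hg' : Continuous fun q : ℝ × M => g' q.1 q.2)
    (h : ∀ x p, HasDerivAt (fun y => g y p) (g' x p) x) (x : ℝ) :
    HasDerivAt (fun y => ∫ p, g y p ∂μ) (∫ p, g' x p ∂μ) x := by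
  obtain ⟨C, hC⟩ := ((isCompact_Icc (a := x - 1) (b := x + 1)).prod
    (isCompact_univ (X := M))).exists_bound_of_continuousOn hg'.continuousOn
  have hs : Set.Icc (x - 1) (x + 1) ∈ nhds x := Icc_mem_nhds (by linarith) (by linarith)
  have hcont : ∀ y, Continuous (g y) := fun y => hg.comp (Continuous.prodMk_right y)
  have hcont' : ∀ y, Continuous (g' y) := fun y => hg'.comp (Continuous.prodMk_right y)
  exact (hasDerivAt_integral_of_dominated_loc_of_deriv_le (bound := fun _ => C) hs
    (Filter.Eventually.of_forall fun y => (hcont y).measurable.aestronglyMeasurable)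
    (integrable_of_continuous_of_compactSpace_s2 μ (hcont x))
    (hcont' x).measurable.aestronglyMeasurable
    (Filter.Eventually.of_forall fun p y hy => hC (y, p) ⟨hy, trivial⟩)
    (integrable_const C)
    (Filter.Eventually.of_forall fun p y _ => h y p)).2

theorem calabiInner_self_pos [μ.IsOpenPosMeasure] {u a : M → ℝ} (hu : Continuous u)
    (ha : Continuous a) (h0 : a ≠ 0) : 0 < calabiInner μ u a a := by
  obtain ⟨p, hp⟩ := Function.ne_iff.1 h0
  refine Continuous.integral_pos_of_hasCompactSupport_nonneg_nonzero (x := p) (by fun_prop)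
    (HasCompactSupport.of_compactSpace _)
    (fun q => mul_nonneg (mul_self_nonneg _) (exp_pos _).le) ?_
  have : a p ≠ 0 := hp
  positivity

theorem calabiInner_linearCombination {u a b w : M → ℝ} (hu : Continuous u) (ha : Continuous a)
    (hb : Continuous b) (hw : Continuous w) (x y k : ℝ) :
    calabiInner μ u (fun p => x * a p + y * b p + k) w
      = x * calabiInner μ u a w + y * calabiInner μ u b w + k * ∫ p, w p * exp (u p) ∂μ := by
  have hi : ∀ {f : M → ℝ}, Continuous f → Integrable f μ :=
    integrable_of_continuous_of_compactSpace_s2 μ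
  simp only [calabiInner]
  rw [← integral_const_mul, ← integral_const_mul, ← integral_const_mul,
    ← integral_add (hi (by fun_prop)) (hi (by fun_prop)),
    ← integral_add (hi (by fun_prop)) (hi (by fun_prop))]
  congr 1
  ext p
  ring

/-- The strict Cauchy–Schwarz inequality for the Calabi metric. -/
theorem calabiInner_gram_pos [μ.IsOpenPosMeasure] {u a b : M → ℝ} (hu : Continuous u)
    (ha : Continuous a) (hb : Continuous b) (h : LinearIndependent ℝ ![a, b]) :
    0 < calabiInner μ u a a * calabiInner μ u b b - calabiInner μ u a b ^ 2 := by
  have haa := calabiInner_self_pos μ hu ha (h.ne_zero 0)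
  set A := calabiInner μ u a a with hA
  set C := calabiInner μ u a b with hC
  have hw : (fun p => -C * a p + A * b p + 0) ≠ 0 := by
    intro h0
    refine haa.ne' (LinearIndependent.pair_iff.1 h (-C) A ?_).2
    ext p
    simpa using congrFun h0 p
  have hpos := calabiInner_self_pos μ hu (by fun_prop) hw
  rw [calabiInner_linearCombination μ hu ha hb (by fun_prop), calabiInner_comm μ u a,
    calabiInner_comm μ u b, calabiInner_linearCombination μ hu ha hb ha,
    calabiInner_linearCombination μ hu ha hb hb, calabiInner_comm μ u b a, ← hA, ← hC] at hpos
  refine pos_of_mul_pos_right (a := A) ?_ haa.le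
  linarith

end CompactIntegral

/-- The sectional curvature of the Calabi metric is positive, constant,
equal to `1/(4 Vol)`. -/
theorem calabi_sectional_curvature
    {M : Type*} [TopologicalSpace M] [CompactSpace M] [Nonempty M]
    [MeasurableSpace M] [BorelSpace M]
    (μ : Measure M) [IsFiniteMeasure μ] [μ.IsOpenPosMeasure]
    (Vol : ℝ) (hVol : Vol = (μ Set.univ).toReal) (hVolpos : 0 < Vol)
    (u : ℝ → ℝ → M → ℝ)
    (hu : SmoothFamily (fun z : ℝ × ℝ => u z.1 z.2))
    (huC : ∀ s t, ∫ p, Real.exp (u s t p) ∂μ = Vol)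
    (s t : ℝ)
    (hindep : LinearIndependent ℝ
      ![fun p => deriv (fun s' => u s' t p) s, fun p => deriv (fun t' => u s t' p) t]) :
    0 < calabiInner μ (u s t) (fun p => deriv (fun s' => u s' t p) s)
          (fun p => deriv (fun s' => u s' t p) s)
        * calabiInner μ (u s t) (fun p => deriv (fun t' => u s t' p) t)
          (fun p => deriv (fun t' => u s t' p) t)
        - (calabiInner μ (u s t) (fun p => deriv (fun s' => u s' t p) s)
            (fun p => deriv (fun t' => u s t' p) t)) ^ 2
    ∧
    - calabiInner μ (u s t) (fun p => sectCurvOp μ Vol u s t p)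
          (fun p => deriv (fun t' => u s t' p) t)
        / (calabiInner μ (u s t) (fun p => deriv (fun s' => u s' t p) s)
              (fun p => deriv (fun s' => u s' t p) s)
            * calabiInner μ (u s t) (fun p => deriv (fun t' => u s t' p) t)
              (fun p => deriv (fun t' => u s t' p) t)
            - (calabiInner μ (u s t) (fun p => deriv (fun s' => u s' t p) s)
                (fun p => deriv (fun t' => u s t' p) t)) ^ 2)
      = 1 / (4 * Vol) := by
  have hM : ∀ {F : ℝ × ℝ → M → ℝ}, SmoothFamily F → ∀ z, Continuous (F z) := fun hF z =>
    hF.continuous_uncurry_s2.comp (Continuous.prodMk_right z)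
  have hγ₁ : ∀ s t : ℝ, HasDerivAt (fun y : ℝ => (y, t)) ((1, 0) : ℝ × ℝ) s := fun s t =>
    (hasDerivAt_id s).prodMk (hasDerivAt_const s t)
  have hγ₂ : ∀ s t : ℝ, HasDerivAt (fun y : ℝ => (s, y)) ((0, 1) : ℝ × ℝ) t := fun s t =>
    (hasDerivAt_const t s).prodMk (hasDerivAt_id t)
  set U : ℝ × ℝ → M → ℝ := fun z => u z.1 z.2 with hU
  set a := paramDeriv ((1, 0) : ℝ × ℝ) U with ha_def
  set b := paramDeriv ((0, 1) : ℝ × ℝ) U with hb_def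
  have ha : SmoothFamily a := hu.paramDeriv _
  have hb : SmoothFamily b := hu.paramDeriv _
  set e := paramDeriv ((1, 0) : ℝ × ℝ) a with he_def
  set c := paramDeriv ((0, 1) : ℝ × ℝ) a with hc_def
  have he : SmoothFamily e := ha.paramDeriv _
  have hc : SmoothFamily c := ha.paramDeriv _
  set d := paramDeriv ((0, 1) : ℝ × ℝ) e with hd_def
  have U_s : ∀ s t p, HasDerivAt (fun y => u y t p) (a (s, t) p) s := fun s t p =>
    hu.hasDerivAt_comp (hγ₁ s t) p
  have U_t : ∀ s t p, HasDerivAt (fun y => u s y p) (b (s, t) p) t := fun s t p =>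
    hu.hasDerivAt_comp (hγ₂ s t) p
  have a_s : ∀ s t p, HasDerivAt (fun y => a (y, t) p) (e (s, t) p) s := fun s t p =>
    ha.hasDerivAt_comp (hγ₁ s t) p
  have a_t : ∀ s t p, HasDerivAt (fun y => a (s, y) p) (c (s, t) p) t := fun s t p =>
    ha.hasDerivAt_comp (hγ₂ s t) p
  have b_s : ∀ s t p, HasDerivAt (fun y => b (y, t) p) (c (s, t) p) s := fun s t p => by
    rw [hc_def, ha_def, hu.paramDeriv_comm]
    exact hb.hasDerivAt_comp (hγ₁ s t) p
  have e_t : ∀ s t p, HasDerivAt (fun y => e (s, y) p) (d (s, t) p) t := fun s t p =>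
    he.hasDerivAt_comp (hγ₂ s t) p
  have c_s : ∀ s t p, HasDerivAt (fun y => c (y, t) p) (d (s, t) p) s := fun s t p => by
    rw [hd_def, he_def, ha.paramDeriv_comm]
    exact hc.hasDerivAt_comp (hγ₁ s t) p
  have u_cont := hu.continuous_uncurry_s2
  have a_cont := ha.continuous_uncurry_s2
  have b_cont := hb.continuous_uncurry_s2
  have c_cont := hc.continuous_uncurry_s2
  have e_cont := he.continuous_uncurry_s2
  have slice₁ : ∀ {F : ℝ × ℝ → M → ℝ}, (Continuous fun q : (ℝ × ℝ) × M => F q.1 q.2) →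
      Continuous fun q : ℝ × M => F (q.1, t) q.2 := fun hF =>
    hF.comp ((continuous_fst.prodMk continuous_const).prodMk continuous_snd)
  have slice₂ : ∀ {F : ℝ × ℝ → M → ℝ}, (Continuous fun q : (ℝ × ℝ) × M => F q.1 q.2) →
      Continuous fun q : ℝ × M => F (s, q.1) q.2 := fun hF =>
    hF.comp ((continuous_const.prodMk continuous_fst).prodMk continuous_snd)
  have hb_zero : ∫ p, b (s, t) p * exp (u s t p) ∂μ = 0 := by
    have h := hasDerivAt_integral_of_continuous_uncurry_s2 μ (g := fun y p => exp (U (s, y) p))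
      (g' := fun y p => exp (U (s, y) p) * b (s, y) p)
      (slice₂ (F := fun z p => exp (U z p)) (by fun_prop))
      (slice₂ (F := fun z p => exp (U z p) * b z p) (by fun_prop))
      (fun y p => (U_t s y p).exp) t
    simp only [hU, huC] at h
    simpa only [mul_comm] using h.unique (hasDerivAt_const t Vol)
  have hI_s : DifferentiableAt ℝ (fun y => ∫ q, a (y, t) q * b (y, t) q * exp (u y t q) ∂μ) s :=
    (hasDerivAt_integral_of_continuous_uncurry_s2 μ
      (slice₁ (F := fun z q => a z q * b z q * exp (U z q)) (by fun_prop))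
      (slice₁ (F := fun z q => (e z q * b z q + a z q * c z q) * exp (U z q)
        + a z q * b z q * (exp (U z q) * a z q)) (by fun_prop))
      (fun y q => ((a_s y t q).mul (b_s y t q)).mul (U_s y t q).exp) s).differentiableAt
  have hI_t : DifferentiableAt ℝ (fun y => ∫ q, a (s, y) q * a (s, y) q * exp (u s y q) ∂μ) t :=
    (hasDerivAt_integral_of_continuous_uncurry_s2 μ
      (slice₂ (F := fun z q => a z q * a z q * exp (U z q)) (by fun_prop))
      (slice₂ (F := fun z q => (c z q * a z q + a z q * c z q) * exp (U z q)
        + a z q * a z q * (exp (U z q) * b z q)) (by fun_prop))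
      (fun y q => ((a_t s y q).mul (a_t s y q)).mul (U_t s y q).exp) t).differentiableAt
  have curv : ∀ p₀ p, sectCurvOp μ Vol u s t p
      = 1 / (4 * Vol) * calabiInner μ (u s t) (a (s, t)) (b (s, t)) * a (s, t) p
        + -(1 / (4 * Vol) * calabiInner μ (u s t) (a (s, t)) (a (s, t))) * b (s, t) p
        + (sectCurvOp μ Vol u s t p₀
          - 1 / (4 * Vol) * calabiInner μ (u s t) (a (s, t)) (b (s, t)) * a (s, t) p₀
          + 1 / (4 * Vol) * calabiInner μ (u s t) (a (s, t)) (a (s, t)) * b (s, t) p₀) := by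
    intro p₀ p
    have hA : ∀ p, HasDerivAt (fun y => c (y, t) p + 1 / 2 * a (y, t) p * b (y, t) p
        + 1 / (2 * Vol) * ∫ q, a (y, t) q * b (y, t) q * exp (u y t q) ∂μ) _ s := fun p =>
      ((c_s s t p).add (((a_s s t p).const_mul (1 / 2)).mul (b_s s t p))).add
        (hI_s.hasDerivAt.const_mul (1 / (2 * Vol)))
    have hB : ∀ p, HasDerivAt (fun y => e (s, y) p + 1 / 2 * a (s, y) p * a (s, y) p
        + 1 / (2 * Vol) * ∫ q, a (s, y) q * a (s, y) q * exp (u s y q) ∂μ) _ t := fun p =>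
      ((e_t s t p).add (((a_t s t p).const_mul (1 / 2)).mul (a_t s t p))).add
        (hI_t.hasDerivAt.const_mul (1 / (2 * Vol)))
    simp only [sectCurvOp, DtUs, DsUs, calabiD, (U_s _ _ _).deriv, (U_t _ _ _).deriv,
      (a_s _ _ _).deriv, (a_t _ _ _).deriv, (hA _).deriv, (hB _).deriv, calabiInner]
    ring
  obtain ⟨k, hk⟩ : ∃ k, ∀ p, sectCurvOp μ Vol u s t p
      = 1 / (4 * Vol) * calabiInner μ (u s t) (a (s, t)) (b (s, t)) * a (s, t) p
        + -(1 / (4 * Vol) * calabiInner μ (u s t) (a (s, t)) (a (s, t))) * b (s, t) p + k :=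
    ⟨_, curv (Classical.arbitrary M)⟩
  simp only [(U_s _ _ _).deriv, (U_t _ _ _).deriv] at hindep ⊢
  have hpos := calabiInner_gram_pos μ (hM hu (s, t)) (hM ha (s, t)) (hM hb (s, t)) hindep
  refine ⟨hpos, ?_⟩
  simp only [hk]
  rw [calabiInner_linearCombination μ (hM hu (s, t)) (hM ha (s, t)) (hM hb (s, t))
    (hM hb (s, t)), hb_zero, div_eq_iff hpos.ne']
  ring
end

section
/- Let u = u(t) be a smooth curve in 𝒞 defined on an interval I containing 0, and set c² := ∫_M (∂_t u(0))² e^{u(0)} dμ. Then u satisfies the geodesic equation of the Calabi metric, D_t(∂_t u) = ∂_t² u + (1/2)(∂_t u)² + 2 ∫_M (∂_t u)² e^{u} dμ = 0 on I, if and only if it satisfies pointwise on I × M the harmonic-oscillator ordinary differential equation (e^{u/2})_{tt} + c² e^{u/2} = 0. -/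
open MeasureTheory Real

/-- A smooth curve of real functions on `M` defined on a set `I ⊆ ℝ`:
for each point the dependence on the parameter is `C^∞` on `I`, and all time-derivatives
are jointly continuous in (time, point) on `I × M`. -/
def SmoothCurveOn {M : Type*} [TopologicalSpace M] (u : ℝ → M → ℝ) (I : Set ℝ) : Prop :=
  (∀ p, ContDiffOn ℝ (⊤ : ℕ∞) (fun t => u t p) I) ∧
    ∀ n : ℕ, ContinuousOn (fun z : ℝ × M => iteratedDeriv n (fun t => u t z.2) z.1)
      (I ×ˢ (Set.univ : Set M))

section ParametricIntegral

variable {M : Type*} [TopologicalSpace M]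

lemma ContinuousOn.continuous_slice_right {F : ℝ → M → ℝ} {I : Set ℝ}
    (hF : ContinuousOn (fun z : ℝ × M => F z.1 z.2) (I ×ˢ Set.univ)) {t : ℝ} (ht : t ∈ I) :
    Continuous (F t) :=
  hF.comp_continuous (f := fun p => (t, p)) (by fun_prop) fun p => ⟨ht, Set.mem_univ p⟩

variable [CompactSpace M] [MeasurableSpace M] [BorelSpace M]

lemma Continuous.integrable_of_compactSpace_of_isFiniteMeasure {f : M → ℝ} (hf : Continuous f)
    (μ : Measure M) [IsFiniteMeasure μ] : Integrable f μ := by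
  obtain ⟨C, hC⟩ := isCompact_univ.exists_bound_of_continuousOn hf.continuousOn
  exact Integrable.of_bound hf.measurable.aestronglyMeasurable C
    (Filter.Eventually.of_forall fun p => hC p (Set.mem_univ p))

/-- Differentiation under the integral sign over a compact space. -/
lemma hasDerivAt_integral_of_continuousOn_prod (μ : Measure M) [IsFiniteMeasure μ]
    {F F' : ℝ → M → ℝ} {I : Set ℝ} (hI : IsOpen I)
    (hF : ContinuousOn (fun z : ℝ × M => F z.1 z.2) (I ×ˢ Set.univ))
    (hF' : ContinuousOn (fun z : ℝ × M => F' z.1 z.2) (I ×ˢ Set.univ))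
    (hderiv : ∀ t ∈ I, ∀ p, HasDerivAt (fun s => F s p) (F' t p) t) {t : ℝ} (ht : t ∈ I) :
    HasDerivAt (fun s => ∫ p, F s p ∂μ) (∫ p, F' t p ∂μ) t := by
  obtain ⟨ε, hε, hball⟩ := Metric.nhds_basis_closedBall.mem_iff.1 (hI.mem_nhds ht)
  obtain ⟨C, hC⟩ := ((isCompact_closedBall t ε).prod isCompact_univ).exists_bound_of_continuousOn
    (hF'.mono (Set.prod_mono hball (Set.Subset.refl (Set.univ : Set M))))
  have hsub : Metric.ball t ε ⊆ I := Metric.ball_subset_closedBall.trans hball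
  refine (hasDerivAt_integral_of_dominated_loc_of_deriv_le (bound := fun _ => C)
    (Metric.ball_mem_nhds t hε) ?_
    ((hF.continuous_slice_right ht).integrable_of_compactSpace_of_isFiniteMeasure μ)
    (hF'.continuous_slice_right ht).measurable.aestronglyMeasurable ?_
    (integrable_const C) ?_).2
  · filter_upwards [hI.mem_nhds ht] with s hs
    exact (hF.continuous_slice_right hs).measurable.aestronglyMeasurable
  · exact Filter.Eventually.of_forall fun p s hs =>
      hC (s, p) ⟨Metric.ball_subset_closedBall hs, Set.mem_univ p⟩
  · exact Filter.Eventually.of_forall fun p s hs => hderiv s (hsub hs) p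

end ParametricIntegral

namespace SmoothCurveOn

variable {M : Type*} [TopologicalSpace M] {u : ℝ → M → ℝ} {I : Set ℝ}

lemma hasDerivAt (hu : SmoothCurveOn u I) (hI : IsOpen I) {t : ℝ} (ht : t ∈ I) (p : M) :
    HasDerivAt (fun s => u s p) (deriv (fun s => u s p) t) t :=
  (((hu.1 p).differentiableOn (by simp)).differentiableAt (hI.mem_nhds ht)).hasDerivAt

lemma hasDerivAt_deriv (hu : SmoothCurveOn u I) (hI : IsOpen I) {t : ℝ} (ht : t ∈ I) (p : M) :
    HasDerivAt (fun s => deriv (fun r => u r p) s)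
      (deriv (fun s => deriv (fun r => u r p) s) t) t := by
  have h : ContDiffOn ℝ 1 (deriv fun r => u r p) I :=
    (hu.1 p).deriv_of_isOpen hI (by norm_cast)
  exact ((h.differentiableOn (by simp)).differentiableAt (hI.mem_nhds ht)).hasDerivAt

lemma continuousOn (hu : SmoothCurveOn u I) :
    ContinuousOn (fun z : ℝ × M => u z.1 z.2) (I ×ˢ Set.univ) := by
  simpa using hu.2 0

lemma continuousOn_deriv (hu : SmoothCurveOn u I) :
    ContinuousOn (fun z : ℝ × M => deriv (fun s => u s z.2) z.1) (I ×ˢ Set.univ) := by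
  simpa using hu.2 1

lemma continuousOn_deriv_deriv (hu : SmoothCurveOn u I) :
    ContinuousOn (fun z : ℝ × M => deriv (fun s => deriv (fun r => u r z.2) s) z.1)
      (I ×ˢ Set.univ) := by
  have h := hu.2 2
  simp only [iteratedDeriv_succ, iteratedDeriv_zero] at h
  exact h

lemma deriv_deriv_exp_half (hu : SmoothCurveOn u I) (hI : IsOpen I) {t : ℝ} (ht : t ∈ I) (p : M) :
    deriv (fun s => deriv (fun r => Real.exp (u r p / 2)) s) t
      = Real.exp (u t p / 2) / 2 * (deriv (fun s => deriv (fun r => u r p) s) t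
        + (1 / 2) * (deriv (fun s => u s p) t) ^ 2) := by
  have h : ∀ s ∈ I, HasDerivAt (fun r => Real.exp (u r p / 2))
      (Real.exp (u s p / 2) * (deriv (fun r => u r p) s / 2)) s :=
    fun s hs => ((hu.hasDerivAt hI hs p).div_const 2).exp
  have heq : (fun s => deriv (fun r => Real.exp (u r p / 2)) s) =ᶠ[nhds t]
      fun s => Real.exp (u s p / 2) * (deriv (fun r => u r p) s / 2) := by
    filter_upwards [hI.mem_nhds ht] with s hs using (h s hs).deriv
  rw [heq.deriv_eq, ((h t ht).fun_mul ((hu.hasDerivAt_deriv hI ht p).div_const 2)).deriv]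
  ring

variable [CompactSpace M] [MeasurableSpace M] [BorelSpace M]
  {μ : Measure M} [IsFiniteMeasure μ] {V : ℝ}

lemma integral_deriv_mul_exp_eq_zero (hu : SmoothCurveOn u I) (hI : IsOpen I)
    (hV : ∀ t ∈ I, ∫ p, Real.exp (u t p) ∂μ = V) {t : ℝ} (ht : t ∈ I) :
    ∫ p, Real.exp (u t p) * deriv (fun s => u s p) t ∂μ = 0 := by
  have h := hasDerivAt_integral_of_continuousOn_prod μ hI
    (F := fun t p => Real.exp (u t p))
    (F' := fun t p => Real.exp (u t p) * deriv (fun s => u s p) t)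
    hu.continuousOn.rexp (hu.continuousOn.rexp.mul hu.continuousOn_deriv)
    (fun t ht p => (hu.hasDerivAt hI ht p).exp) ht
  refine h.unique ((hasDerivAt_const t V).congr_of_eventuallyEq ?_)
  filter_upwards [hI.mem_nhds ht] with s hs using hV s hs

lemma integral_deriv_deriv_mul_exp_eq_zero (hu : SmoothCurveOn u I) (hI : IsOpen I)
    (hV : ∀ t ∈ I, ∫ p, Real.exp (u t p) ∂μ = V) {t : ℝ} (ht : t ∈ I) :
    ∫ p, (Real.exp (u t p) * deriv (fun s => u s p) t * deriv (fun s => u s p) t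
      + Real.exp (u t p) * deriv (fun s => deriv (fun r => u r p) s) t) ∂μ = 0 := by
  have hc := hu.continuousOn.rexp
  have h := hasDerivAt_integral_of_continuousOn_prod μ hI
    (F := fun t p => Real.exp (u t p) * deriv (fun s => u s p) t)
    (F' := fun t p => Real.exp (u t p) * deriv (fun s => u s p) t * deriv (fun s => u s p) t
      + Real.exp (u t p) * deriv (fun s => deriv (fun r => u r p) s) t)
    (hc.mul hu.continuousOn_deriv)
    (((hc.mul hu.continuousOn_deriv).mul hu.continuousOn_deriv).add
      (hc.mul hu.continuousOn_deriv_deriv))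
    (fun t ht p => (hu.hasDerivAt hI ht p).exp.fun_mul (hu.hasDerivAt_deriv hI ht p)) ht
  refine h.unique ((hasDerivAt_const t (0 : ℝ)).congr_of_eventuallyEq ?_)
  filter_upwards [hI.mem_nhds ht] with s hs using hu.integral_deriv_mul_exp_eq_zero hI hV hs

/-- The energy `∫ (∂ₜu)² e^u` is constant along a curve with `∂ₜ²u + (∂ₜu)² / 2` independent of
the point. -/
lemma energy_eq (hu : SmoothCurveOn u I) (hI : IsOpen I) (hconn : IsPreconnected I)
    (hV : ∀ t ∈ I, ∫ p, Real.exp (u t p) ∂μ = V) {a : ℝ → ℝ}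
    (ha : ∀ t ∈ I, ∀ p, deriv (fun s => deriv (fun r => u r p) s) t
      + (1 / 2) * (deriv (fun s => u s p) t) ^ 2 = a t) {s t : ℝ} (hs : s ∈ I) (ht : t ∈ I) :
    ∫ q, (deriv (fun r => u r q) s) ^ 2 * Real.exp (u s q) ∂μ
      = ∫ q, (deriv (fun r => u r q) t) ^ 2 * Real.exp (u t q) ∂μ := by
  have hc := hu.continuousOn.rexp
  have hd := hu.continuousOn_deriv
  have key : ∀ r ∈ I, HasDerivAt
      (fun r => ∫ q, (deriv (fun s => u s q) r) ^ 2 * Real.exp (u r q) ∂μ) 0 r := by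
    intro r hr
    have h := hasDerivAt_integral_of_continuousOn_prod μ hI
      (F := fun t q => (deriv (fun s => u s q) t) ^ 2 * Real.exp (u t q))
      (F' := fun t q => 2 * (deriv (fun s => u s q) t)
          * deriv (fun s => deriv (fun r => u r q) s) t * Real.exp (u t q)
        + (deriv (fun s => u s q) t) ^ 2 * (Real.exp (u t q) * deriv (fun s => u s q) t))
      ((hd.pow 2).mul hc)
      ((((continuousOn_const.mul hd).mul hu.continuousOn_deriv_deriv).mul hc).add
        ((hd.pow 2).mul (hc.mul hd)))
      (fun t ht p => by
        simpa using ((hu.hasDerivAt_deriv hI ht p).fun_pow 2).fun_mul (hu.hasDerivAt hI ht p).exp)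
      hr
    convert h using 1
    calc (0 : ℝ) = 2 * a r * ∫ p, Real.exp (u r p) * deriv (fun s => u s p) r ∂μ := by
          rw [hu.integral_deriv_mul_exp_eq_zero hI hV hr, mul_zero]
      _ = _ := by
          rw [← integral_const_mul]
          refine integral_congr_ae (Filter.Eventually.of_forall fun p => ?_)
          simp only [← ha r hr p]
          ring
  exact hI.is_const_of_deriv_eq_zero hconn
    (fun r hr => (key r hr).differentiableAt.differentiableWithinAt)
    (fun r hr => (key r hr).deriv) hs ht

/-- If `∂ₜ²u + (∂ₜu)² / 2` does not depend on the point, twice differentiating the volume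
constraint expresses it through the energy. -/
lemma energy_eq_of_forall_eq (hu : SmoothCurveOn u I) (hI : IsOpen I)
    (hV : ∀ t ∈ I, ∫ p, Real.exp (u t p) ∂μ = V) {a t : ℝ} (ht : t ∈ I)
    (ha : ∀ p, deriv (fun s => deriv (fun r => u r p) s) t
      + (1 / 2) * (deriv (fun s => u s p) t) ^ 2 = a) :
    ∫ q, (deriv (fun r => u r q) t) ^ 2 * Real.exp (u t q) ∂μ = -2 * a * V := by
  have hc := hu.continuousOn.rexp
  have h := hu.integral_deriv_deriv_mul_exp_eq_zero hI hV ht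
  have hi₁ : Integrable
      (fun q => (1 / 2) * ((deriv (fun r => u r q) t) ^ 2 * Real.exp (u t q))) μ :=
    (((hu.continuousOn_deriv.continuous_slice_right (F := fun t q => deriv (fun r => u r q) t)
      ht).pow 2).mul (hc.continuous_slice_right (F := fun t q => Real.exp (u t q)) ht)
      |>.integrable_of_compactSpace_of_isFiniteMeasure μ).const_mul _
  have hi₂ : Integrable (fun q => a * Real.exp (u t q)) μ :=
    ((hc.continuous_slice_right (F := fun t q => Real.exp (u t q)) ht)
      |>.integrable_of_compactSpace_of_isFiniteMeasure μ).const_mul _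
  have heq : ∀ q, Real.exp (u t q) * deriv (fun s => u s q) t * deriv (fun s => u s q) t
      + Real.exp (u t q) * deriv (fun s => deriv (fun r => u r q) s) t
      = (1 / 2) * ((deriv (fun r => u r q) t) ^ 2 * Real.exp (u t q))
        + a * Real.exp (u t q) := by
    intro q
    rw [← ha q]
    ring
  simp only [heq] at h
  rw [integral_add hi₁ hi₂, integral_const_mul, integral_const_mul, hV t ht] at h
  linarith

end SmoothCurveOn

/-- With `Vol = 1/4`, a smooth curve `u` in 𝒞 on an interval `I ∋ 0`
satisfies the geodesic equation `∂_t² u + (1/2)(∂_t u)² + 2 ∫ (∂_t u)² e^u dμ = 0` on `I`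
if and only if it satisfies the harmonic-oscillator ODE `(e^{u/2})_tt + c² e^{u/2} = 0`
pointwise on `I × M`, where `c² = ∫ (∂_t u(0))² e^{u(0)} dμ`. -/
theorem calabi_geodesic_iff_harmonic_oscillator
    {M : Type*} [TopologicalSpace M] [CompactSpace M] [Nonempty M]
    [MeasurableSpace M] [BorelSpace M]
    (μ : Measure M) [IsFiniteMeasure μ] [μ.IsOpenPosMeasure]
    (hVol : (μ Set.univ).toReal = 1 / 4)
    (I : Set ℝ) (hIopen : IsOpen I) (hIconn : IsPreconnected I) (hI0 : (0 : ℝ) ∈ I)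
    (u : ℝ → M → ℝ) (hu : SmoothCurveOn u I)
    (huC : ∀ t ∈ I, ∫ p, Real.exp (u t p) ∂μ = 1 / 4) :
    (∀ t ∈ I, ∀ p, deriv (fun s => deriv (fun r => u r p) s) t
        + (1 / 2) * (deriv (fun s => u s p) t) ^ 2
        + 2 * ∫ q, (deriv (fun s => u s q) t) ^ 2 * Real.exp (u t q) ∂μ = 0)
    ↔
    (∀ t ∈ I, ∀ p, deriv (fun s => deriv (fun r => Real.exp (u r p / 2)) s) t
        + (∫ q, (deriv (fun s => u s q) 0) ^ 2 * Real.exp (u 0 q) ∂μ)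
          * Real.exp (u t p / 2) = 0) := by
  have hosc : ∀ t ∈ I, ∀ p (c : ℝ),
      deriv (fun s => deriv (fun r => Real.exp (u r p / 2)) s) t + c * Real.exp (u t p / 2) = 0
      ↔ deriv (fun s => deriv (fun r => u r p) s) t
        + (1 / 2) * (deriv (fun s => u s p) t) ^ 2 = -2 * c := by
    intro t ht p c
    rw [hu.deriv_deriv_exp_half hIopen ht p]
    have hpos := Real.exp_pos (u t p / 2)
    constructor
    · intro h
      refine mul_left_cancel₀ hpos.ne' ?_
      linarith
    · intro h
      rw [h]
      ring
  constructor
  · intro h t ht p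
    have hE := hu.energy_eq (μ := μ) hIopen hIconn huC
      (a := fun t => -2 * ∫ q, (deriv (fun s => u s q) t) ^ 2 * Real.exp (u t q) ∂μ)
      (fun t ht p => by linarith [h t ht p]) hI0 ht
    rw [hosc t ht p, hE]
    linarith [h t ht p]
  · intro h t ht p
    have hE := hu.energy_eq_of_forall_eq (μ := μ) hIopen huC ht fun p => (hosc t ht p _).1 (h t ht p)
    rw [(hosc t ht p _).1 (h t ht p), hE]
    ring
end

section
/- Let u₀ ≠ u₁ ∈ 𝒞 and let t₀ ∈ (0, π/2) be the unique solution of ∫_M e^{(u₀+u₁)/2} dμ = (1/4) cos(t₀). Define F(t) := e^{u₀/2} ( cos(t) + e^{(u₁−u₀)/2} sin(t)/sin(t₀) − cos(t₀) sin(t)/sin(t₀) ). Then F(t) > 0 on M for every t ∈ [0, t₀], the curve u(t) := 2 log F(t) lies in 𝒞 for every t ∈ [0, t₀], satisfies the geodesic equation (e^{u/2})_{tt} + e^{u/2} = 0 pointwise, and solves the Dirichlet problem u(0) = u₀, u(t₀) = u₁. -/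
open MeasureTheory Real

/-- A linear combination of `cos` and `sin` solves `f'' + f = 0` wherever it is positive, also when
written as `exp (2 * log f / 2)`. -/
theorem deriv_deriv_exp_log_cos_sin (A B t : ℝ) (ht : 0 < A * cos t + B * sin t) :
    deriv (fun s => deriv (fun r => exp (2 * log (A * cos r + B * sin r) / 2)) s) t
      + exp (2 * log (A * cos t + B * sin t) / 2) = 0 := by
  have hexp : ∀ x : ℝ, 0 < x → exp (2 * log x / 2) = x := fun x hx => by
    rw [mul_div_cancel_left₀ _ two_ne_zero, exp_log hx]
  have hcont : Continuous fun r => A * cos r + B * sin r := by fun_prop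
  have heq : (fun r => exp (2 * log (A * cos r + B * sin r) / 2))
      =ᶠ[nhds t] fun r => A * cos r + B * sin r :=
    (hcont.continuousAt.eventually (lt_mem_nhds ht)).mono fun r hr => hexp _ hr
  have hderiv : deriv (fun r => A * cos r + B * sin r) = fun s => A * -sin s + B * cos s :=
    funext fun s => (((hasDerivAt_cos s).const_mul A).add ((hasDerivAt_sin s).const_mul B)).deriv
  have hderiv₂ : deriv (fun s => A * -sin s + B * cos s) t = A * -cos t + B * -sin t :=
    (((hasDerivAt_sin t).neg.const_mul A).add ((hasDerivAt_cos t).const_mul B)).deriv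
  rw [heq.deriv.deriv_eq, hderiv, hderiv₂, hexp _ ht]
  ring

/-- Explicit solution of the Dirichlet problem for the geodesic equation
of the Calabi metric: given `u₀ ≠ u₁` in 𝒞 and the unique `t₀ ∈ (0, π/2)` with
`∫ e^{(u₀+u₁)/2} dμ = (1/4) cos t₀`, the curve `u(t) = 2 log F(t)` with
`F(t) = e^{u₀/2}(cos t + e^{(u₁−u₀)/2} sin t / sin t₀ − cos t₀ sin t / sin t₀)` is a
geodesic in 𝒞 joining `u₀` to `u₁`. -/
theorem calabi_dirichlet_problem
    {M : Type*} [TopologicalSpace M] [CompactSpace M] [Nonempty M]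
    [MeasurableSpace M] [BorelSpace M]
    (μ : Measure M) [IsFiniteMeasure μ] [μ.IsOpenPosMeasure]
    (hVol : (μ Set.univ).toReal = 1 / 4)
    (u₀ : M → ℝ) (hu₀c : Continuous u₀) (hu₀C : ∫ p, Real.exp (u₀ p) ∂μ = 1 / 4)
    (u₁ : M → ℝ) (hu₁c : Continuous u₁) (hu₁C : ∫ p, Real.exp (u₁ p) ∂μ = 1 / 4)
    (hne : u₀ ≠ u₁)
    (t₀ : ℝ) (ht₀ : t₀ ∈ Set.Ioo 0 (Real.pi / 2))
    (ht₀eq : (∫ p, Real.exp ((u₀ p + u₁ p) / 2) ∂μ) = (1 / 4) * Real.cos t₀) :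
    let F : ℝ → M → ℝ := fun t p => Real.exp (u₀ p / 2) * (Real.cos t
      + Real.exp ((u₁ p - u₀ p) / 2) * Real.sin t / Real.sin t₀
      - Real.cos t₀ * Real.sin t / Real.sin t₀)
    let u : ℝ → M → ℝ := fun t p => 2 * Real.log (F t p)
    -- positivity
    (∀ t ∈ Set.Icc 0 t₀, ∀ p, 0 < F t p) ∧
    -- the curve lies in 𝒞
    (∀ t ∈ Set.Icc 0 t₀, ∫ p, Real.exp (u t p) ∂μ = 1 / 4) ∧
    -- geodesic equation
    (∀ t ∈ Set.Icc 0 t₀, ∀ p,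
      deriv (fun s => deriv (fun r => Real.exp (u r p / 2)) s) t
        + Real.exp (u t p / 2) = 0) ∧
    -- boundary conditions
    u 0 = u₀ ∧ u t₀ = u₁ := by
  intro F u
  have hsin : 0 < sin t₀ := sin_pos_of_pos_of_lt_pi ht₀.1 (by linarith [ht₀.2, pi_pos])
  have hmul : ∀ p, exp (u₀ p / 2) * exp ((u₁ p - u₀ p) / 2) = exp (u₁ p / 2) := fun p => by
    rw [← exp_add]; ring_nf
  have hF : ∀ t p, F t p =
      (exp (u₀ p / 2) * sin (t₀ - t) + exp (u₁ p / 2) * sin t) / sin t₀ := fun t p => by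
    simp only [F]
    rw [← hmul, sin_sub]
    field_simp
    ring
  have hpos : ∀ t ∈ Set.Icc 0 t₀, ∀ p, 0 < F t p := by
    rintro t ⟨h0, h1⟩ p
    have hπ : t₀ < π := by linarith [ht₀.2, pi_pos]
    rw [hF]
    refine div_pos ?_ hsin
    rcases h0.eq_or_lt with rfl | h0
    · simpa using mul_pos (exp_pos _) hsin
    · have hs : 0 < sin t := sin_pos_of_pos_of_lt_pi h0 (by linarith)
      have hs' : 0 ≤ sin (t₀ - t) := sin_nonneg_of_nonneg_of_le_pi (by linarith) (by linarith)
      positivity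
  have hint : ∀ f : M → ℝ, Continuous f → Integrable f μ := fun f hf =>
    hf.integrable_of_hasCompactSupport (HasCompactSupport.of_compactSpace f)
  refine ⟨hpos, fun t ht => ?_, fun t ht p => ?_, ?_, ?_⟩
  · have hexp : ∀ p, exp (u t p) =
        (sin (t₀ - t) / sin t₀) ^ 2 * exp (u₀ p) + (sin t / sin t₀) ^ 2 * exp (u₁ p)
          + 2 * (sin (t₀ - t) / sin t₀) * (sin t / sin t₀) * exp ((u₀ p + u₁ p) / 2) := by
      intro p
      have h₀ : exp (u₀ p) = exp (u₀ p / 2) ^ 2 := by rw [← exp_nat_mul]; ring_nf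
      have h₁ : exp (u₁ p) = exp (u₁ p / 2) ^ 2 := by rw [← exp_nat_mul]; ring_nf
      have h₀₁ : exp ((u₀ p + u₁ p) / 2) = exp (u₀ p / 2) * exp (u₁ p / 2) := by
        rw [← exp_add]; ring_nf
      have hu : exp (u t p) = F t p ^ 2 := by
        simp only [u]
        rw [two_mul, exp_add, exp_log (hpos t ht p), sq]
      rw [hu, hF, h₀, h₁, h₀₁]
      ring
    simp_rw [hexp]
    rw [integral_add, integral_add, integral_const_mul, integral_const_mul, integral_const_mul,
      hu₀C, hu₁C, ht₀eq, sin_sub]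
    · field_simp
      linear_combination (sin t₀ ^ 2) * sin_sq_add_cos_sq t - (sin t ^ 2) * sin_sq_add_cos_sq t₀
    all_goals exact hint _ (by fun_prop)
  · have hFlin : ∀ r, F r p = exp (u₀ p / 2) * cos r
        + (exp (u₁ p / 2) - exp (u₀ p / 2) * cos t₀) / sin t₀ * sin r := fun r => by
      rw [hF, sin_sub]
      field_simp
      ring
    have hp := hpos t ht p
    simp only [u, hFlin] at hp ⊢
    exact deriv_deriv_exp_log_cos_sin _ _ t hp
  · funext p
    simp only [u, hF]
    rw [sub_zero, sin_zero, mul_zero, add_zero, mul_div_cancel_right₀ _ hsin.ne', log_exp]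
    ring
  · funext p
    simp only [u, hF]
    rw [sub_self, sin_zero, mul_zero, zero_add, mul_div_cancel_right₀ _ hsin.ne', log_exp]
    ring
end

section
/- Geodesics between two points are unique modulo parametrization: let u₀ ∈ 𝒞, let v₀, w₀ ∈ T_{u₀}𝒞 with ‖v₀‖_{u₀} = ‖w₀‖_{u₀} = 1, and let s, t ∈ (−π/2, π/2) be such that the unit-speed geodesics γ(·,u₀,v₀) and γ(·,u₀,w₀) are defined at s and t respectively and γ(s, u₀, v₀) = γ(t, u₀, w₀) =: u₁ with u₁ ≠ u₀. Then either (t = s and w₀ = v₀) or (t = −s and w₀ = −v₀). -/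
open MeasureTheory Real

/-- Geodesics of the Calabi metric between two points are unique modulo
parametrization: if two unit-speed geodesics issued from `u₀` reach the same point
`u₁ ≠ u₀` at times `s, t ∈ (−π/2, π/2)`, then either `t = s` and the initial velocities
coincide, or `t = −s` and they are opposite. -/
theorem calabi_geodesic_uniqueness_mod_param
    {M : Type*} [TopologicalSpace M] [CompactSpace M] [Nonempty M]
    [MeasurableSpace M] [BorelSpace M]
    (μ : Measure M) [IsFiniteMeasure μ] [μ.IsOpenPosMeasure]
    (hVol : (μ Set.univ).toReal = 1 / 4)
    (u₀ : M → ℝ) (hu₀c : Continuous u₀) (hu₀C : ∫ p, Real.exp (u₀ p) ∂μ = 1 / 4)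
    (v₀ : M → ℝ) (hv₀c : Continuous v₀) (hv₀T : ∫ p, v₀ p * Real.exp (u₀ p) ∂μ = 0)
    (hv₀n : ∫ p, (v₀ p) ^ 2 * Real.exp (u₀ p) ∂μ = 1)
    (w₀ : M → ℝ) (hw₀c : Continuous w₀) (hw₀T : ∫ p, w₀ p * Real.exp (u₀ p) ∂μ = 0)
    (hw₀n : ∫ p, (w₀ p) ^ 2 * Real.exp (u₀ p) ∂μ = 1)
    (s t : ℝ)
    (hs : s ∈ Set.Ioo (-(Real.pi / 2)) (Real.pi / 2))
    (ht : t ∈ Set.Ioo (-(Real.pi / 2)) (Real.pi / 2))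
    -- both geodesics are defined at the given times
    (hdefv : ∀ p, 0 < Real.cos s + v₀ p / 2 * Real.sin s)
    (hdefw : ∀ p, 0 < Real.cos t + w₀ p / 2 * Real.sin t)
    -- they reach the same point `u₁`
    (heq : (fun p => u₀ p + 2 * Real.log (Real.cos s + v₀ p / 2 * Real.sin s))
         = (fun p => u₀ p + 2 * Real.log (Real.cos t + w₀ p / 2 * Real.sin t)))
    -- which is different from `u₀`
    (hne : (fun p => u₀ p + 2 * Real.log (Real.cos s + v₀ p / 2 * Real.sin s)) ≠ u₀) :
    (t = s ∧ w₀ = v₀) ∨ (t = -s ∧ w₀ = -v₀) := by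
  have integrable_mul_exp (f : M → ℝ) (hf : Continuous f) :
      Integrable (fun p => f p * Real.exp (u₀ p)) μ :=
    (hf.mul (Real.continuous_exp.comp hu₀c)).integrable_of_hasCompactSupport
      (HasCompactSupport.of_compactSpace _)
  have integral_factor (f : M → ℝ) (hf : Continuous f)
      (hf0 : ∫ p, f p * Real.exp (u₀ p) ∂μ = 0) (r : ℝ) :
      ∫ p, (Real.cos r + f p / 2 * Real.sin r) * Real.exp (u₀ p) ∂μ = Real.cos r / 4 := by
    have hexp : Integrable (fun p => Real.exp (u₀ p)) μ := by
      simpa using integrable_mul_exp (fun _ => 1) continuous_const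
    calc ∫ p, (Real.cos r + f p / 2 * Real.sin r) * Real.exp (u₀ p) ∂μ
        = ∫ p, (Real.cos r * Real.exp (u₀ p)
            + Real.sin r / 2 * (f p * Real.exp (u₀ p))) ∂μ := by
          congr 1
          ext p
          ring
      _ = Real.cos r / 4 := by
          rw [integral_add (hexp.const_mul _) ((integrable_mul_exp f hf).const_mul _),
            integral_const_mul, integral_const_mul, hu₀C, hf0]
          ring
  have hfactor (p : M) :
      Real.cos s + v₀ p / 2 * Real.sin s = Real.cos t + w₀ p / 2 * Real.sin t := by
    have h := congrFun heq p
    exact Real.log_injOn_pos (hdefv p) (hdefw p) (by linarith)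
  have hcos : Real.cos s = Real.cos t := by
    have hv := integral_factor v₀ hv₀c hv₀T s
    have hw := integral_factor w₀ hw₀c hw₀T t
    simp only [hfactor] at hv
    linarith
  have habs : |t| = |s| := by
    have hs' : |s| < Real.pi / 2 := abs_lt.2 hs
    have ht' : |t| < Real.pi / 2 := abs_lt.2 ht
    refine Real.injOn_cos ⟨abs_nonneg t, ?_⟩ ⟨abs_nonneg s, ?_⟩ ?_
    · linarith [Real.pi_pos]
    · linarith [Real.pi_pos]
    · rw [Real.cos_abs, Real.cos_abs, hcos]
  have hs0 : s ≠ 0 := by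
    rintro rfl
    exact hne (by simp)
  have hsin : Real.sin s ≠ 0 := fun h =>
    hs0 ((Real.sin_eq_zero_iff_of_lt_of_lt (by linarith [hs.1, Real.pi_pos])
      (by linarith [hs.2, Real.pi_pos])).1 h)
  rcases abs_eq_abs.1 habs with rfl | rfl
  · refine Or.inl ⟨rfl, funext fun p => mul_right_cancel₀ hsin ?_⟩
    linarith [hfactor p]
  · refine Or.inr ⟨rfl, funext fun p => mul_right_cancel₀ hsin ?_⟩
    have h := hfactor p
    rw [Real.cos_neg, Real.sin_neg] at h
    simp only [Pi.neg_apply]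
    linarith
end

section
/- The function d(u₀,u₁) := arccos( 4 ∫_M e^{(u₀+u₁)/2} dμ ) is a distance function on 𝒞: for all u₀, u₁, u₂ ∈ 𝒞 one has (i) 0 ≤ d(u₀,u₁) < π/2; (ii) d(u₀,u₁) = d(u₁,u₀); (iii) d(u₀,u₁) = 0 if and only if u₀ = u₁; (iv) the triangle inequality d(u₀,u₂) ≤ d(u₀,u₁) + d(u₁,u₂). -/
open MeasureTheory Real

/-- The unit vector `2 e^{u/2}` of `L²(μ)` attached to a conformal factor `u`. -/
noncomputable def conformalVector {M : Type*} [TopologicalSpace M] [CompactSpace M]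
    [MeasurableSpace M] [BorelSpace M] (μ : Measure M) [IsFiniteMeasure μ] (u : C(M, ℝ)) :
    Lp ℝ 2 μ :=
  ContinuousMap.toLp 2 μ ℝ
    ⟨fun p => 2 * Real.exp (u p / 2), by fun_prop⟩

section ConformalVector

variable {M : Type*} [TopologicalSpace M] [CompactSpace M] [MeasurableSpace M] [BorelSpace M]
  (μ : Measure M) [IsFiniteMeasure μ]

theorem inner_conformalVector (u v : C(M, ℝ)) :
    inner ℝ (conformalVector μ u) (conformalVector μ v)
      = 4 * ∫ p, Real.exp ((u p + v p) / 2) ∂μ := by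
  rw [conformalVector, conformalVector, ContinuousMap.inner_toLp, ← integral_const_mul]
  congr 1 with p
  simp only [ContinuousMap.coe_mk, conj_trivial]
  rw [add_div, Real.exp_add]
  ring

theorem norm_conformalVector (u : C(M, ℝ)) (hu : ∫ p, Real.exp (u p) ∂μ = 1 / 4) :
    ‖conformalVector μ u‖ = 1 := by
  have h := inner_conformalVector μ u u
  simp only [add_self_div_two, hu, real_inner_self_eq_norm_sq] at h
  exact (pow_eq_one_iff_of_nonneg (norm_nonneg _) two_ne_zero).1 (by linarith)

theorem angle_conformalVector (u v : C(M, ℝ)) (hu : ∫ p, Real.exp (u p) ∂μ = 1 / 4)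
    (hv : ∫ p, Real.exp (v p) ∂μ = 1 / 4) :
    InnerProductGeometry.angle (conformalVector μ u) (conformalVector μ v)
      = Real.arccos (4 * ∫ p, Real.exp ((u p + v p) / 2) ∂μ) := by
  rw [InnerProductGeometry.angle, norm_conformalVector μ u hu, norm_conformalVector μ v hv,
    inner_conformalVector, one_mul, div_one]

theorem conformalVector_injective [μ.IsOpenPosMeasure] :
    Function.Injective (conformalVector μ) := by
  intro u v h
  ext p
  have h' := DFunLike.congr_fun (ContinuousMap.toLp_injective (p := 2) (𝕜 := ℝ) μ h) p
  simpa using h'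

end ConformalVector

/-- The function `d(u₀,u₁) = arccos(4 ∫ e^{(u₀+u₁)/2} dμ)` is a distance
function on 𝒞: it takes values in `[0, π/2)`, is symmetric, vanishes exactly on the
diagonal, and satisfies the triangle inequality. -/
theorem calabi_distance_is_distance
    {M : Type*} [TopologicalSpace M] [CompactSpace M] [Nonempty M]
    [MeasurableSpace M] [BorelSpace M]
    (μ : Measure M) [IsFiniteMeasure μ] [μ.IsOpenPosMeasure]
    (hVol : (μ Set.univ).toReal = 1 / 4)
    (u₀ : M → ℝ) (hu₀c : Continuous u₀) (hu₀C : ∫ p, Real.exp (u₀ p) ∂μ = 1 / 4)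
    (u₁ : M → ℝ) (hu₁c : Continuous u₁) (hu₁C : ∫ p, Real.exp (u₁ p) ∂μ = 1 / 4)
    (u₂ : M → ℝ) (hu₂c : Continuous u₂) (hu₂C : ∫ p, Real.exp (u₂ p) ∂μ = 1 / 4) :
    -- (i) range
    (0 ≤ Real.arccos (4 * ∫ p, Real.exp ((u₀ p + u₁ p) / 2) ∂μ) ∧
      Real.arccos (4 * ∫ p, Real.exp ((u₀ p + u₁ p) / 2) ∂μ) < Real.pi / 2) ∧
    -- (ii) symmetry
    Real.arccos (4 * ∫ p, Real.exp ((u₀ p + u₁ p) / 2) ∂μ)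
      = Real.arccos (4 * ∫ p, Real.exp ((u₁ p + u₀ p) / 2) ∂μ) ∧
    -- (iii) vanishing iff equal
    (Real.arccos (4 * ∫ p, Real.exp ((u₀ p + u₁ p) / 2) ∂μ) = 0 ↔ u₀ = u₁) ∧
    -- (iv) triangle inequality
    Real.arccos (4 * ∫ p, Real.exp ((u₀ p + u₂ p) / 2) ∂μ)
      ≤ Real.arccos (4 * ∫ p, Real.exp ((u₀ p + u₁ p) / 2) ∂μ)
        + Real.arccos (4 * ∫ p, Real.exp ((u₁ p + u₂ p) / 2) ∂μ) := by
  have hμ : NeZero μ := ⟨by rintro rfl; norm_num at hVol⟩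
  have h01 := angle_conformalVector μ ⟨u₀, hu₀c⟩ ⟨u₁, hu₁c⟩ hu₀C hu₁C
  have h12 := angle_conformalVector μ ⟨u₁, hu₁c⟩ ⟨u₂, hu₂c⟩ hu₁C hu₂C
  have h02 := angle_conformalVector μ ⟨u₀, hu₀c⟩ ⟨u₂, hu₂c⟩ hu₀C hu₂C
  simp only [ContinuousMap.coe_mk] at h01 h12 h02
  refine ⟨⟨Real.arccos_nonneg _, ?_⟩, ?_, ⟨fun h => ?_, ?_⟩, ?_⟩
  · rw [Real.arccos_lt_pi_div_two]
    have hint : Integrable (fun p => Real.exp ((u₀ p + u₁ p) / 2)) μ :=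
      Continuous.integrable_of_hasCompactSupport (by fun_prop)
        (HasCompactSupport.of_compactSpace _)
    have := integral_exp_pos hint
    positivity
  · simp only [add_comm]
  · rw [← h01, InnerProductGeometry.angle, Real.arccos_eq_zero,
      norm_conformalVector μ _ hu₀C, norm_conformalVector μ _ hu₁C, one_mul, div_one] at h
    have hle := real_inner_le_one_of_norm_eq_one (norm_conformalVector μ ⟨u₀, hu₀c⟩ hu₀C)
      (norm_conformalVector μ ⟨u₁, hu₁c⟩ hu₁C)
    have heq := (inner_eq_one_iff_of_norm_eq_one (norm_conformalVector μ _ hu₀C)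
      (norm_conformalVector μ _ hu₁C)).1 (le_antisymm hle h)
    exact congrArg DFunLike.coe (conformalVector_injective μ heq)
  · rintro rfl
    simp only [add_self_div_two, hu₀C]
    norm_num
  · rw [← h01, ← h12, ← h02]
    exact InnerProductGeometry.angle_le_angle_add_angle _ _ _
end
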